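/- arXiv:1611.05499 — 2 statements merged into one kernel-verified Lean document; each statement's English description precedes it below -/
import Mathlib

section
/- Let q be an odd prime power, n ≥ 1, and let x ∈ sp(2n,q). For each monic irreducible polynomial φ over F_q and each integer k ≥ 1 set r_{φ,k} = rank(φ(x)^{k-1}) − rank(φ(x)^k) (ranks of 2n×2n matrices over F_q, with φ(x)^0 = I). Set o = ∑_{k ≥ 1, k odd} (r_{X,k} − r_{X,k+1}), where X denotes the monic irreducible polynomial X itself. Then the number of y ∈ sp(2n,q) with xy = yx equals q^e, where e is the natural number satisfying 2e = o + ∑_φ (1/deg φ) ∑_{k ≥ 1} r_{φ,k}² (the outer sum over all monic irreducible polynomials φ over F_q, with only finitely many nonzero terms). -/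
open Matrix

/-- The `2n × 2n` matrix `J = [[0, I],[-I, 0]]` defining the symplectic group. -/
noncomputable def sympJ (F : Type) [Field F] (n : ℕ) :
    Matrix (Fin n ⊕ Fin n) (Fin n ⊕ Fin n) F :=
  Matrix.fromBlocks 0 1 (-1) 0

/-- `r_{φ,k} = rank(φ(x)^{k-1}) - rank(φ(x)^k)`. -/
noncomputable def rDiff {F : Type} [Field F] {N : Type} [Fintype N] [DecidableEq N]
    (x : Matrix N N F) (f : Polynomial F) (k : ℕ) : ℕ :=
  Matrix.rank ((Polynomial.aeval x) f ^ (k - 1)) - Matrix.rank ((Polynomial.aeval x) f ^ k)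


instance bilinSubmoduleAddCommGroup {F : Type} [Field F] {V : Type} [AddCommGroup V] [Module F V]
    (S : Submodule F (V →ₗ[F] V →ₗ[F] F)) : AddCommGroup S :=
  @Submodule.addCommGroup F (V →ₗ[F] V →ₗ[F] F) _ (LinearMap.addCommGroup) _ S

instance bilinSubmoduleFinite {F : Type} [Field F] {V : Type} [AddCommGroup V] [Module F V]
    [FiniteDimensional F V] (S : Submodule F (V →ₗ[F] V →ₗ[F] F)) : Module.Finite F S :=
  @FiniteDimensional.finiteDimensional_submodule F (V →ₗ[F] V →ₗ[F] F) _
    (LinearMap.addCommGroup) _ _ S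

/-- `ε`-symmetric bilinear forms for which `f` is skew. -/
def skewForms {F : Type} [Field F] {V : Type} [AddCommGroup V] [Module F V]
    (ε : F) (f : V →ₗ[F] V) : Submodule F (V →ₗ[F] V →ₗ[F] F) where
  carrier := {B | (∀ u v, B v u = ε * B u v) ∧ ∀ u v, B (f u) v = - B u (f v)}
  zero_mem' := by simp
  add_mem' := by
    rintro a b ⟨h1, h2⟩ ⟨h3, h4⟩
    refine ⟨fun u v => ?_, fun u v => ?_⟩
    · simp only [LinearMap.add_apply, h1 u v, h3 u v]; ring
    · simp only [LinearMap.add_apply, h2 u v, h4 u v]; ring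
  smul_mem' := by
    rintro c b ⟨h1, h2⟩
    refine ⟨fun u v => ?_, fun u v => ?_⟩
    · simp only [LinearMap.smul_apply, h1 u v, smul_eq_mul]; ring
    · simp only [LinearMap.smul_apply, h2 u v, smul_eq_mul]; ring

/-- reduction to the image -/
theorem skewForms_step {F : Type} [Field F] {V W C : Type} [AddCommGroup V] [Module F V]
    [AddCommGroup W] [Module F W] [AddCommGroup C] [Module F C]
    [FiniteDimensional F V] [FiniteDimensional F W] [FiniteDimensional F C]
    (g : V →ₗ[F] W) (hg : Function.Surjective g)
    (i : W →ₗ[F] V) (j : C →ₗ[F] V) (a : V →ₗ[F] W) (c : V →ₗ[F] C)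
    (hai : ∀ w, a (i w) = w) (haj : ∀ w, a (j w) = 0) (hci : ∀ w, c (i w) = 0)
    (hcj : ∀ w, c (j w) = w) (hV : ∀ v, i (a v) + j (c v) = v)
    (ε : F) :
    Module.finrank F (skewForms ε (i ∘ₗ g)) =
      Module.finrank F (skewForms (-ε) (g ∘ₗ i)) +
        Module.finrank F (skewForms ε (0 : C →ₗ[F] C)) := by
  obtain ⟨s, hs⟩ := g.exists_rightInverse_of_surjective (LinearMap.range_eq_top.2 hg)
  have hs' : ∀ w, g (s w) = w := fun w => by simpa using LinearMap.congr_fun hs w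
  -- basic formula: B (s (g u)) (i w) = B u (i w)
  have key : ∀ B ∈ skewForms ε (i ∘ₗ g), ∀ u w, B (s (g u)) (i w) = B u (i w) := by
    rintro B ⟨h1, h2⟩ u w
    have e1 := h2 (s (g u)) (s w)
    have e2 := h2 u (s w)
    simp only [LinearMap.comp_apply, hs'] at e1 e2
    rw [e1] at e2
    exact neg_injective e2
  let T : skewForms ε (i ∘ₗ g) →ₗ[F] (skewForms (-ε) (g ∘ₗ i) × skewForms ε (0 : C →ₗ[F] C)) :=
    { toFun := fun B => (⟨B.1.compl₁₂ s i, by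
          obtain ⟨B, hB⟩ := B
          have hk := key B hB
          obtain ⟨h1, h2⟩ := hB
          refine ⟨fun u v => ?_, fun u v => ?_⟩
          · have e1 := h2 (s u) (s v)
            have e2 := h1 (i u) (s v)
            simp only [LinearMap.comp_apply, hs'] at e1 e2
            simp only [LinearMap.compl₁₂_apply]
            rw [e2, e1]; ring
          · have e1 := h2 (i u) (s v)
            simp only [LinearMap.comp_apply, hs'] at e1
            simp only [LinearMap.compl₁₂_apply, LinearMap.comp_apply, hk]
            have e2 := h2 (s u) (i v)
            simp only [LinearMap.comp_apply, hs'] at e2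
            exact e2⟩,
        ⟨B.1.compl₁₂ j j, by
          obtain ⟨B, ⟨h1, h2⟩⟩ := B
          refine ⟨fun u v => ?_, fun u v => ?_⟩
          · simpa using h1 _ _
          · simp⟩)
      map_add' := fun B B' => by ext <;> simp
      map_smul' := fun r B => by ext <;> simp }
  have hT : Function.Bijective T := by
    constructor
    · rw [injective_iff_map_eq_zero]
      rintro ⟨B, hB⟩ h0
      have hk := key B hB
      have hB' := hB
      obtain ⟨h1, h2⟩ := hB'
      have hp : ∀ w w', B (s w) (i w') = 0 := fun w w' => by
        have := congrArg (fun z => z.1.1 w w') h0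
        simpa [T] using this
      have hq : ∀ w w', B (j w) (j w') = 0 := fun w w' => by
        have := congrArg (fun z => z.2.1 w w') h0
        simpa [T] using this
      have hp' : ∀ u w', B u (i w') = 0 := fun u w' => by rw [← hk, hp]
      have hp'' : ∀ u w', B (i w') u = 0 := fun u w' => by rw [h1 u, hp', mul_zero]
      apply Subtype.ext
      refine LinearMap.ext₂ fun u v => ?_
      show B u v = 0
      rw [← hV u, ← hV v]
      simp [hp', hp'', hq]
    · rintro ⟨⟨P, p1, p2⟩, ⟨Q, q1, q2⟩⟩
      simp only [LinearMap.comp_apply] at p2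
      let B : V →ₗ[F] V →ₗ[F] F := P.compl₁₂ g a - P.compl₁₂ a (g ∘ₗ j ∘ₗ c) + Q.compl₁₂ c c
      have hBa : ∀ u v, B u v = P (g u) (a v) - P (a u) (g (j (c v))) + Q (c u) (c v) := by
        intro u v; simp [B]
      have hg1 : ∀ v, g v = g (i (a v)) + g (j (c v)) := fun v => by rw [← map_add, hV]
      have hsym : ∀ u v, B v u = ε * B u v := by
        intro u v
        rw [hBa, hBa, q1 (c u) (c v), p1 (a u) (g v), p1 (g (j (c u))) (a v), hg1 v, hg1 u]
        simp only [map_add, LinearMap.add_apply, p2]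
        ring
      have hB : B ∈ skewForms ε (i ∘ₗ g) := by
        refine ⟨hsym, fun u v => ?_⟩
        simp only [LinearMap.comp_apply, hBa, hai, hci, map_zero, LinearMap.zero_apply]
        have h3 := p2 (g u) (a v)
        rw [h3, hg1 v, map_add]; ring
      refine ⟨⟨B, hB⟩, ?_⟩
      refine Prod.ext (Subtype.ext (LinearMap.ext₂ fun u v => ?_)) 
        (Subtype.ext (LinearMap.ext₂ fun u v => ?_))
      · show B (s u) (i v) = P u v
        simp [hBa, hai, hci, hs']
      · show B (j u) (j v) = Q u v
        simp [hBa, haj, hcj]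
  rw [(LinearEquiv.ofBijective T hT).finrank_eq, Module.finrank_prod]

theorem skewForms_zero {F : Type} [Field F] (h2 : (2 : F) ≠ 0) {C : Type}
    [AddCommGroup C] [Module F C] [FiniteDimensional F C] :
    Module.finrank F (skewForms (1 : F) (0 : C →ₗ[F] C)) =
      Module.finrank F (skewForms (-1 : F) (0 : C →ₗ[F] C)) + Module.finrank F C := by
  let b := Module.finBasis F C
  set c := Module.finrank F C with hc
  let sg : Fin c → Fin c → F := fun i j => if i < j then 1 else if j < i then -1 else 0
  have sg_anti : ∀ i j, sg j i = - sg i j := by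
    intro i j
    rcases lt_trichotomy i j with h | h | h
    · simp [sg, h, h.not_gt]
    · simp [sg, h]
    · simp [sg, h, h.not_gt]
  have sg_self : ∀ i, sg i i = 0 := by intro i; simp [sg]
  have sg_sq : ∀ i j, i ≠ j → sg i j * sg i j = 1 := by
    intro i j hij
    rcases lt_or_gt_of_ne hij with h | h
    · simp [sg, h]
    · simp [sg, h, h.not_gt]
  let ofM : Matrix (Fin c) (Fin c) F ≃ₗ[F] (C →ₗ[F] C →ₗ[F] F) := Matrix.toLinearMap₂ b b
  have ofM_basis : ∀ M i j, ofM M (b i) (b j) = M i j := by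
    intro M i j
    simp [ofM, Matrix.toLinearMap₂_apply_basis, -Matrix.toLinearMap₂_apply]
  have mem_iff : ∀ (ε : F) (B : C →ₗ[F] C →ₗ[F] F), B ∈ skewForms ε (0 : C →ₗ[F] C) ↔
      ∀ i j, B (b j) (b i) = ε * B (b i) (b j) := by
    intro ε B
    constructor
    · rintro ⟨h, -⟩ i j; exact h _ _
    · intro h
      have : B.flip = ε • B := by
        refine LinearMap.ext_basis b b fun i j => ?_
        simpa using h i j
      refine ⟨fun u v => ?_, by simp⟩
      have := LinearMap.congr_fun₂ this u v
      simpa using this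
  let T : skewForms (1 : F) (0 : C →ₗ[F] C) →ₗ[F]
      (skewForms (-1 : F) (0 : C →ₗ[F] C) × (Fin c → F)) :=
    { toFun := fun B => (⟨ofM (Matrix.of fun i j => sg i j * B.1 (b i) (b j)), by
          have := (mem_iff _ _).1 B.2
          rw [mem_iff]
          intro i j
          rw [ofM_basis, ofM_basis, Matrix.of_apply, Matrix.of_apply, sg_anti i j, this i j]
          ring⟩, fun i => B.1 (b i) (b i))
      map_add' := fun B B' => by
        refine Prod.ext (Subtype.ext (LinearMap.ext_basis b b fun i j => ?_)) (funext fun i => ?_)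
        · simp [ofM_basis, mul_add]
        · simp
      map_smul' := fun r B => by
        refine Prod.ext (Subtype.ext (LinearMap.ext_basis b b fun i j => ?_)) (funext fun i => ?_)
        · simp [ofM_basis, mul_left_comm]
        · simp }
  have hT : Function.Bijective T := by
    constructor
    · rw [injective_iff_map_eq_zero]
      intro B h0
      refine Subtype.ext (LinearMap.ext_basis b b fun i j => ?_)
      show B.1 (b i) (b j) = 0
      by_cases hij : i = j
      · subst hij
        exact congrFun (congrArg Prod.snd h0) i
      · have := congrArg (fun z => z.1.1 (b i) (b j)) h0
        have h3 : sg i j * B.1 (b i) (b j) = 0 := by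
          simpa [T, ofM_basis] using this
        have h4 : sg i j ≠ 0 := fun h => by
          have := sg_sq i j hij
          rw [h] at this; simp at this
        exact (mul_eq_zero.1 h3).resolve_left h4
    · rintro ⟨⟨P, hP⟩, d⟩
      rw [mem_iff] at hP
      have hPi : ∀ i, P (b i) (b i) = 0 := by
        intro i
        have := hP i i
        have h3 : 2 * P (b i) (b i) = 0 := by linear_combination this
        exact (mul_eq_zero.1 h3).resolve_left h2
      refine ⟨⟨ofM (Matrix.of fun i j => sg i j * P (b i) (b j) + if i = j then d i else 0), ?_⟩, ?_⟩
      · rw [mem_iff]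
        intro i j
        rw [ofM_basis, ofM_basis, Matrix.of_apply, Matrix.of_apply, sg_anti i j, hP i j]
        by_cases hij : i = j
        · subst hij; simp
        · simp [hij, Ne.symm hij]
      · refine Prod.ext (Subtype.ext (LinearMap.ext_basis b b fun i j => ?_)) (funext fun i => ?_)
        · simp only [T, LinearMap.coe_mk, AddHom.coe_mk, ofM_basis, Matrix.of_apply]
          by_cases hij : i = j
          · subst hij; simp [hPi, sg_self]
          · simp only [hij, if_false, add_zero]
            rw [← mul_assoc, sg_sq i j hij, one_mul]
        · simp [T, ofM_basis, sg_self]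
  rw [(LinearEquiv.ofBijective T hT).finrank_eq, Module.finrank_prod]
  simp

theorem skewForms_diff {F : Type} [Field F] (h2 : (2 : F) ≠ 0) (K : ℕ) :
    ∀ {V : Type} [AddCommGroup V] [Module F V] [FiniteDimensional F V] (f : V →ₗ[F] V),
    Module.finrank F V ≤ K →
    (Module.finrank F (skewForms (1 : F) f) : ℤ) - Module.finrank F (skewForms (-1 : F) f) =
      ∑ k ∈ Finset.range K, (-1) ^ k *
        ((Module.finrank F (LinearMap.range (f ^ k)) : ℤ) -
          Module.finrank F (LinearMap.range (f ^ (k + 1)))) := by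
  induction K with
  | zero =>
    intro V _ _ _ f hV
    have h0 : Module.finrank F V = 0 := by omega
    have : Subsingleton V := Module.finrank_zero_iff.1 h0
    have hz : ∀ ε : F, Module.finrank F (skewForms ε f) = 0 := by
      intro ε
      apply Module.finrank_zero_iff.2
      constructor
      intro a b
      refine Subtype.ext (LinearMap.ext₂ fun u v => ?_)
      rw [Subsingleton.elim u 0, map_zero, map_zero]
    simp [hz]
  | succ K ih =>
    intro V _ _ _ f hV
    by_cases hf : Function.Surjective f
    · have hinj := (LinearMap.injective_iff_surjective.2 hf)
      have hr : ∀ k, LinearMap.range (f ^ k) = ⊤ := by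
        intro k
        rw [LinearMap.range_eq_top, Module.End.coe_pow]
        exact hf.iterate k
      have := skewForms_step (C := PUnit) f hf LinearMap.id 0 LinearMap.id 0
        (by simp) (by simp) (by simp) (by simp) (by simp) (1 : F)
      have hz : Module.finrank F (skewForms (1 : F) (0 : PUnit →ₗ[F] PUnit)) = 0 := by
        apply Module.finrank_zero_iff.2
        constructor
        intro a b
        refine Subtype.ext (LinearMap.ext₂ fun u v => ?_)
        rw [Subsingleton.elim u 0, map_zero, map_zero]
      rw [hz] at this
      simp only [LinearMap.id_comp, LinearMap.comp_id] at this
      rw [Finset.sum_eq_zero (fun k _ => by rw [hr, hr, sub_self, mul_zero]), this]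
      simp
    · -- W = range f
      obtain ⟨C, hC⟩ := Submodule.exists_isCompl (LinearMap.range f)
      let W := LinearMap.range f
      have hWlt : Module.finrank F W < Module.finrank F V := by
        apply Submodule.finrank_lt
        rwa [Ne, LinearMap.range_eq_top]
      have hadd := Submodule.finrank_add_eq_of_isCompl hC
      have step := fun (ε : F) => skewForms_step (C := C) f.rangeRestrict
        f.surjective_rangeRestrict W.subtype C.subtype
        (W.projectionOnto C hC) (C.projectionOnto W hC.symm)
        (by intro w; simp [W])
        (by intro w; simp [W])
        (by intro w; simp [W])
        (by intro w; simp [W])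
        (by
          intro v
          have := Submodule.projection_add_projection_eq_self hC v
          simpa [W] using this) ε
      have s1 := step 1
      have s2 := step (-1)
      have s0 := skewForms_zero h2 (C := C)
      have e1 : W.subtype ∘ₗ f.rangeRestrict = f := by ext; rfl
      rw [e1] at s1 s2
      set f' : W →ₗ[F] W := f.rangeRestrict ∘ₗ W.subtype with hf'
      have ih' := ih f' (by omega)
      rw [neg_neg] at s2
      have hpow : ∀ k (w : W), (((f' ^ k) w : W) : V) = (f ^ k) (w : V) := by
        intro k
        induction k with
        | zero => intro w; simp
        | succ k ihk =>
          intro w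
          rw [pow_succ', pow_succ', Module.End.mul_apply, Module.End.mul_apply, ← ihk]
          rfl
      have hrk : ∀ k, Module.finrank F (LinearMap.range (f' ^ k)) =
          Module.finrank F (LinearMap.range (f ^ (k + 1))) := by
        intro k
        have : (LinearMap.range (f' ^ k)).map W.subtype = LinearMap.range (f ^ (k + 1)) := by
          ext v
          simp only [Submodule.mem_map, LinearMap.mem_range]
          constructor
          · rintro ⟨_, ⟨⟨_, ⟨u, rfl⟩⟩, rfl⟩, rfl⟩
            refine ⟨u, ?_⟩
            rw [Submodule.subtype_apply, hpow, pow_succ, Module.End.mul_apply]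
          · rintro ⟨u, rfl⟩
            refine ⟨_, ⟨⟨f u, ⟨u, rfl⟩⟩, rfl⟩, ?_⟩
            rw [Submodule.subtype_apply, hpow, pow_succ, Module.End.mul_apply]
        rw [← this]
        exact (LinearEquiv.finrank_eq (Submodule.equivMapOfInjective _ W.injective_subtype _))
      rw [Finset.sum_range_succ']
      simp only [hrk] at ih'
      have hneg : ∑ k ∈ Finset.range K, (-1 : ℤ) ^ (k + 1) *
        ((Module.finrank F (LinearMap.range (f ^ (k + 1))) : ℤ) -
          Module.finrank F (LinearMap.range (f ^ (k + 1 + 1)))) = -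
          ∑ k ∈ Finset.range K, (-1 : ℤ) ^ k *
        ((Module.finrank F (LinearMap.range (f ^ (k + 1))) : ℤ) -
          Module.finrank F (LinearMap.range (f ^ (k + 1 + 1)))) := by
        rw [← Finset.sum_neg_distrib]
        refine Finset.sum_congr rfl fun k _ => by ring
      rw [hneg, ← ih', s1, s2, s0]
      have e0 : Module.finrank F (LinearMap.range (f ^ 0)) = Module.finrank F V := by
        rw [pow_zero]
        have : LinearMap.range (1 : V →ₗ[F] V) = ⊤ := LinearMap.range_id
        rw [this, finrank_top]
      rw [e0, ← hadd]
      have e3 : f ^ (0 + 1) = f := pow_one f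
      rw [e3]
      push_cast
      ring

section
open Polynomial

theorem finrank_torsionBy_quot {F : Type} [Field F] (a b : F[X]) (ha : a ≠ 0) (hb : b ≠ 0) :
    Module.finrank F (Submodule.torsionBy F[X] (F[X] ⧸ Submodule.span F[X] {a * b}) a) =
      a.natDegree := by
  let ψ : F[X] →ₗ[F[X]] (F[X] ⧸ Submodule.span F[X] {a * b}) :=
    (Submodule.mkQ _) ∘ₗ (LinearMap.toSpanSingleton F[X] F[X] b)
  have hψ : ∀ r, ψ r = Submodule.Quotient.mk (r * b) := fun r => rfl
  have hr : LinearMap.range ψ = Submodule.torsionBy F[X] (F[X] ⧸ Submodule.span F[X] {a * b}) a := by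
    ext z
    rw [LinearMap.mem_range, Submodule.mem_torsionBy_iff]
    constructor
    · rintro ⟨r, rfl⟩
      rw [hψ, ← Submodule.Quotient.mk_smul, Submodule.Quotient.mk_eq_zero,
        Submodule.mem_span_singleton]
      exact ⟨r, by simp only [smul_eq_mul]; ring⟩
    · obtain ⟨r, rfl⟩ := Submodule.Quotient.mk_surjective _ z
      intro h
      rw [← Submodule.Quotient.mk_smul, Submodule.Quotient.mk_eq_zero,
        Submodule.mem_span_singleton] at h
      obtain ⟨s, hs⟩ := h
      refine ⟨s, ?_⟩
      rw [hψ]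
      congr 1
      apply mul_left_cancel₀ ha
      simp only [smul_eq_mul] at hs
      linear_combination hs
  have hk : LinearMap.ker ψ = Submodule.span F[X] {a} := by
    ext r
    rw [LinearMap.mem_ker, hψ, Submodule.Quotient.mk_eq_zero, Submodule.mem_span_singleton,
      Submodule.mem_span_singleton]
    constructor
    · rintro ⟨s, hs⟩
      refine ⟨s, mul_right_cancel₀ hb ?_⟩
      simp only [smul_eq_mul] at hs ⊢
      linear_combination hs
    · rintro ⟨s, hs⟩
      refine ⟨s, ?_⟩
      simp only [smul_eq_mul] at hs ⊢
      linear_combination b * hs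
  have e := ψ.quotKerEquivRange
  rw [hr, hk] at e
  rw [← (e.restrictScalars F).finrank_eq]
  exact finrank_quotient_span_eq_natDegree

open Classical in
/-- Dimension of the `φ ^ k`-torsion of `F[X]/(p^e)`. -/
theorem finrank_torsionBy_prime {F : Type} [Field F] (p φ : F[X]) (hp : p.Monic)
    (hp' : Irreducible p) (hφ : φ.Monic) (hφ' : Irreducible φ) (e k : ℕ) :
    Module.finrank F (Submodule.torsionBy F[X] (F[X] ⧸ Submodule.span F[X] {p ^ e}) (φ ^ k)) =
      if p = φ then min e k * φ.natDegree else 0 := by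
  split_ifs with h
  · subst h
    rcases le_total e k with hek | hek
    · have : Submodule.torsionBy F[X] (F[X] ⧸ Submodule.span F[X] {p ^ e}) (p ^ k) = ⊤ := by
        rw [eq_top_iff]
        rintro z -
        obtain ⟨r, rfl⟩ := Submodule.Quotient.mk_surjective _ z
        rw [Submodule.mem_torsionBy_iff, ← Submodule.Quotient.mk_smul,
          Submodule.Quotient.mk_eq_zero, Submodule.mem_span_singleton]
        refine ⟨p ^ (k - e) * r, ?_⟩
        simp only [smul_eq_mul]
        rw [← Nat.sub_add_cancel hek, pow_add]
        simp; ring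
      rw [this, min_eq_left hek, ← natDegree_pow]
      have e2 : Module.finrank F (F[X] ⧸ Submodule.span F[X] {p ^ e}) = (p ^ e).natDegree :=
        finrank_quotient_span_eq_natDegree
      rw [← e2]
      exact (LinearEquiv.restrictScalars F (Submodule.topEquiv (R := F[X]) (M := F[X] ⧸ Submodule.span F[X] {p ^ e}))).finrank_eq
    · have := finrank_torsionBy_quot (p ^ k) (p ^ (e - k)) (pow_ne_zero _ hp.ne_zero) (pow_ne_zero _ hp.ne_zero)
      rw [← pow_add, Nat.add_sub_cancel' hek] at this
      rw [this, natDegree_pow, min_eq_right hek]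
  · have : Submodule.torsionBy F[X] (F[X] ⧸ Submodule.span F[X] {p ^ e}) (φ ^ k) = ⊥ := by
      rw [eq_bot_iff]
      intro z
      obtain ⟨r, rfl⟩ := Submodule.Quotient.mk_surjective _ z
      rw [Submodule.mem_torsionBy_iff, ← Submodule.Quotient.mk_smul,
          Submodule.Quotient.mk_eq_zero, Submodule.mem_bot, Submodule.Quotient.mk_eq_zero]
      have hc : IsCoprime (p ^ e) (φ ^ k) := by
        apply IsCoprime.pow
        rw [hp'.coprime_iff_not_dvd]
        intro hd
        exact h (eq_of_monic_of_associated hp hφ (hp'.associated_of_dvd hφ' hd))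
      intro hm
      have hm' := Ideal.mem_span_singleton.1 hm
      exact Ideal.mem_span_singleton.2 (hc.dvd_of_dvd_mul_left hm')
    rw [this]
    exact Module.finrank_zero_of_subsingleton

variable {F : Type} [Field F] {ι : Type} [Fintype ι] {P : ι → Type} {M M' : Type}
  [∀ i, AddCommGroup (P i)] [∀ i, Module F[X] (P i)] [∀ i, Module F (P i)]
  [∀ i, IsScalarTower F F[X] (P i)]
  [AddCommGroup M] [Module F[X] M] [Module F M] [IsScalarTower F F[X] M]
  [AddCommGroup M'] [Module F[X] M'] [Module F M'] [IsScalarTower F F[X] M']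

theorem finrank_torsionBy_congr (l : M ≃ₗ[F[X]] M') (a : F[X]) :
    Module.finrank F (Submodule.torsionBy F[X] M a) =
      Module.finrank F (Submodule.torsionBy F[X] M' a) := by
  have : (Submodule.torsionBy F[X] M a).map (l : M →ₗ[F[X]] M') = Submodule.torsionBy F[X] M' a := by
    ext z
    simp only [Submodule.mem_map, Submodule.mem_torsionBy_iff]
    constructor
    · rintro ⟨y, hy, rfl⟩
      rw [LinearEquiv.coe_coe, ← map_smul, hy, map_zero]
    · intro h
      exact ⟨l.symm z, by rw [← map_smul, h, map_zero], by simp⟩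
  rw [← this]
  exact ((l.submoduleMap (Submodule.torsionBy F[X] M a)).restrictScalars F).finrank_eq

theorem finrank_torsionBy_pi (a : F[X]) [∀ i, FiniteDimensional F (P i)] :
    Module.finrank F (Submodule.torsionBy F[X] (∀ i, P i) a) =
      ∑ i, Module.finrank F (Submodule.torsionBy F[X] (P i) a) := by
  let T : Submodule.torsionBy F[X] (∀ i, P i) a ≃ₗ[F[X]]
      (∀ i, Submodule.torsionBy F[X] (P i) a) :=
    { toFun := fun z i => ⟨z.1 i, by
        have := z.2
        rw [Submodule.mem_torsionBy_iff] at this ⊢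
        exact congrFun this i⟩
      invFun := fun z => ⟨fun i => (z i).1, by
        rw [Submodule.mem_torsionBy_iff]
        funext i
        exact (z i).2⟩
      map_add' := fun _ _ => rfl
      map_smul' := fun _ _ => rfl
      left_inv := fun _ => rfl
      right_inv := fun _ => rfl }
  rw [(T.restrictScalars F).finrank_eq]
  have : ∀ i, Module.Finite F (Submodule.torsionBy F[X] (P i) a) := fun i =>
    inferInstanceAs (Module.Finite F ((Submodule.torsionBy F[X] (P i) a).restrictScalars F))
  rw [Module.finrank_pi_fintype]

theorem finrank_hom_quot (a : F[X]) :
    Nonempty (((F[X] ⧸ Submodule.span F[X] {a}) →ₗ[F[X]] M) ≃ₗ[F[X]] Submodule.torsionBy F[X] M a) := by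
  refine ⟨LinearEquiv.ofBijective 
    { toFun := fun h => ⟨h (Submodule.Quotient.mk 1), by
        rw [Submodule.mem_torsionBy_iff, ← map_smul, ← Submodule.Quotient.mk_smul]
        have : (Submodule.Quotient.mk (a • (1 : F[X])) : F[X] ⧸ Submodule.span F[X] {a}) = 0 := by
          rw [Submodule.Quotient.mk_eq_zero]
          simp [Submodule.mem_span_singleton_self]
        rw [this, map_zero]⟩
      map_add' := fun _ _ => rfl
      map_smul' := fun _ _ => rfl } ⟨?_, ?_⟩⟩
  · intro h h' hh
    have := congrArg Subtype.val hh
    apply Submodule.linearMap_qext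
    ext
    exact this
  · rintro ⟨m, hm⟩
    refine ⟨Submodule.liftQ _ (LinearMap.toSpanSingleton F[X] M m) ?_, ?_⟩
    · rw [Submodule.span_singleton_le_iff_mem, LinearMap.mem_ker]
      simpa using hm
    · apply Subtype.ext
      exact (Submodule.liftQ_apply _ _ _).trans (one_smul _ _)

theorem finrank_hom_pi [FiniteDimensional F M] (a : ι → F[X]) :
    Module.finrank F ((∀ i, F[X] ⧸ Submodule.span F[X] {a i}) →ₗ[F[X]] M) =
      ∑ i, Module.finrank F (Submodule.torsionBy F[X] M (a i)) := by
  classical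
  have : ∀ i, Module.Finite F (Submodule.torsionBy F[X] M (a i)) := fun i =>
    inferInstanceAs (Module.Finite F ((Submodule.torsionBy F[X] M (a i)).restrictScalars F))
  have l1 := LinearMap.lsum F[X] (fun i => F[X] ⧸ Submodule.span F[X] {a i}) F[X] (M := M)
  have l2 := LinearEquiv.piCongrRight (fun i => (finrank_hom_quot (M := M) (a i)).some)
  rw [((l1.symm.trans l2).restrictScalars F).finrank_eq, Module.finrank_pi_fintype]


theorem exists_primary_decomposition {V : Type} [AddCommGroup V] [Module F V]
    [FiniteDimensional F V] (f : Module.End F V) :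
    ∃ (κ : Type) (_ : Fintype κ) (p : κ → {g : F[X] // g.Monic ∧ Irreducible g}) (e : κ → ℕ),
      Nonempty (Module.AEval' f ≃ₗ[F[X]]
        (∀ i, F[X] ⧸ Submodule.span F[X] {(p i).1 ^ e i})) := by
  classical
  obtain ⟨κ, hκ, p, hp, e, ⟨l⟩⟩ := Module.equiv_directSum_of_isTorsion
    (R := F[X]) (M := Module.AEval' f) (Module.AEval.isTorsion_of_finiteDimensional F V f)
  refine ⟨κ, hκ, fun i => ⟨normalize (p i), monic_normalize (hp i).ne_zero,
    (normalize_associated (p i)).symm.irreducible (hp i)⟩, e, ?_⟩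
  refine ⟨(l.trans (DirectSum.linearEquivFunOnFintype F[X] κ _)).trans
    (LinearEquiv.piCongrRight fun i => Submodule.quotEquivOfEq _ _ ?_)⟩
  exact Ideal.span_singleton_eq_span_singleton.2
    ((normalize_associated (p i)).symm.pow_pow)

/-- The centralizer of a matrix, as a subspace. -/
def commSub {N : Type} [Fintype N] [DecidableEq N] (x : Matrix N N F) :
    Submodule F (Matrix N N F) where
  carrier := {y | x * y = y * x}
  zero_mem' := by simp
  add_mem' := by
    intro a b ha hb
    simp only [Set.mem_ofPred_eq] at *
    rw [mul_add, add_mul, ha, hb]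
  smul_mem' := by
    intro c a ha
    simp only [Set.mem_ofPred_eq] at *
    rw [Matrix.mul_smul, Matrix.smul_mul, ha]

theorem toLin_aeval {N : Type} [Fintype N] [DecidableEq N] (x : Matrix N N F) (g : F[X]) :
    Matrix.toLin' (aeval x g) = aeval (Matrix.toLin' x : Module.End F (N → F)) g := by
  have := Polynomial.aeval_algHom_apply
    (Matrix.toLinAlgEquiv' : Matrix N N F ≃ₐ[F] _).toAlgHom x g
  exact this.symm

theorem rank_add_torsion {N : Type} [Fintype N] [DecidableEq N] (x : Matrix N N F) (g : F[X]) :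
    Matrix.rank (aeval x g) + Module.finrank F (Submodule.torsionBy F[X]
      (Module.AEval' (Matrix.toLin' x : Module.End F (N → F))) g) = Fintype.card N := by
  have h1 := LinearMap.finrank_range_add_finrank_ker (Matrix.toLin' (aeval x g))
  rw [Module.finrank_pi] at h1
  rw [← h1, Matrix.rank, ← Matrix.toLin'_apply']
  congr 1
  rw [toLin_aeval]
  set f : Module.End F (N → F) := Matrix.toLin' x
  let T : LinearMap.ker (aeval f g) ≃ₗ[F]
      ((Submodule.torsionBy F[X] (Module.AEval' f) g).restrictScalars F) :=
    LinearEquiv.ofSubmodules (Module.AEval'.of f) _ _ (by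
      ext z
      simp only [Submodule.mem_map, LinearMap.mem_ker, Submodule.restrictScalars_mem,
        Submodule.mem_torsionBy_iff]
      constructor
      · rintro ⟨y, hy, rfl⟩
        have := Module.AEval.of_aeval_smul (a := f) g y
        refine this.symm.trans ?_
        have h0 : aeval f g • y = 0 := hy
        rw [h0, map_zero]
      · intro h
        refine ⟨(Module.AEval'.of f).symm z, ?_, by simp⟩
        have := Module.AEval.of_symm_smul (a := f) g z
        have h3 : aeval f g • (Module.AEval.of F (N → F) f).symm z = 0 := by
          rw [← this]
          exact (congrArg _ h).trans (map_zero _)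
        exact h3)
  exact T.finrank_eq.symm

theorem finrank_commSub {N : Type} [Fintype N] [DecidableEq N] (x : Matrix N N F) :
    Module.finrank F (commSub x) = Module.finrank F
      (Module.AEval' (Matrix.toLin' x : Module.End F (N → F)) →ₗ[F[X]]
        Module.AEval' (Matrix.toLin' x : Module.End F (N → F))) := by
  set f : Module.End F (N → F) := Matrix.toLin' x with hf
  let o := Module.AEval'.of f
  let T : (Module.AEval' f →ₗ[F[X]] Module.AEval' f) →ₗ[F] commSub x :=
    { toFun := fun h => ⟨LinearMap.toMatrix' 
          ((o.symm : _ →ₗ[F] (N → F)) ∘ₗ (h.restrictScalars F) ∘ₗ (o : (N → F) →ₗ[F] _)), by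
        show _ = _
        apply Matrix.toLin'.injective
        rw [Matrix.toLin'_mul, Matrix.toLin'_mul, Matrix.toLin'_toMatrix']
        refine LinearMap.ext fun v => ?_
        simp only [LinearMap.comp_apply, LinearEquiv.coe_coe, LinearMap.coe_restrictScalars]
        have e1 := Module.AEval'.X_smul_of f v
        have e2 := h.map_smul X (o v)
        have e3 := Module.AEval'.of_symm_X_smul f (h (o v))
        change X • o v = o (f v) at e1
        rw [e1] at e2
        change f (o.symm (h (o v))) = o.symm (h (o (f v)))
        rw [e2]
        exact e3.symm⟩
      map_add' := fun a b => by
        apply Subtype.ext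
        simp only [LinearMap.restrictScalars_add, LinearMap.add_comp, LinearMap.comp_add, map_add,
          Submodule.coe_add]
      map_smul' := fun a b => by
        apply Subtype.ext
        simp only [LinearMap.restrictScalars_smul, LinearMap.smul_comp, LinearMap.comp_smul,
          map_smul, Submodule.coe_smul, RingHom.id_apply] }
  have hT : Function.Bijective T := by
    constructor
    · intro h h' hh
      have h1 := LinearMap.toMatrix'.injective (congrArg Subtype.val hh)
      refine LinearMap.ext fun z => ?_
      have h2 := LinearMap.congr_fun h1 (o.symm z)
      simpa using h2
    · rintro ⟨y, hy⟩
      refine ⟨LinearMap.ofAEval f ((o : (N → F) →ₗ[F] _) ∘ₗ Matrix.toLin' y) ?_, ?_⟩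
      · intro v
        have hy' : x * y = y * x := hy
        have h1 := congrArg Matrix.toLin' hy'
        rw [Matrix.toLin'_mul, Matrix.toLin'_mul] at h1
        have h2 := LinearMap.congr_fun h1 v
        have e1 := Module.AEval'.X_smul_of f (Matrix.toLin' y v)
        refine Eq.trans ?_ e1.symm
        exact congrArg o h2.symm
      · apply Subtype.ext
        apply Matrix.toLin'.injective
        refine LinearMap.ext fun v => ?_
        simp only [T, LinearMap.coe_mk, AddHom.coe_mk, Matrix.toLin'_toMatrix']
        rfl
  exact (LinearEquiv.ofBijective T hT).finrank_eq.symm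

open Classical in
theorem centralizer_data {N : Type} [Fintype N] [DecidableEq N] (x : Matrix N N F) :
    ∃ (κ : Type) (_ : Fintype κ) (p : κ → {g : F[X] // g.Monic ∧ Irreducible g}) (e : κ → ℕ),
      (∀ (φ : {g : F[X] // g.Monic ∧ Irreducible g}) (k : ℕ),
        Matrix.rank ((aeval x φ.1) ^ k) +
          ∑ i, (if p i = φ then min (e i) k * φ.1.natDegree else 0) = Fintype.card N) ∧
      Module.finrank F (commSub x) =
        ∑ i, ∑ j, (if p j = p i then min (e j) (e i) * (p i).1.natDegree else 0) := by
  obtain ⟨κ, hκ, p, e, ⟨l⟩⟩ := exists_primary_decomposition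
    (Matrix.toLin' x : Module.End F (N → F))
  have hfin : ∀ i, FiniteDimensional F (F[X] ⧸ Submodule.span F[X] {(p i).1 ^ e i}) := fun i =>
    ((p i).2.1.pow (e i)).finite_quotient
  have key : ∀ (φ : {g : F[X] // g.Monic ∧ Irreducible g}) (k : ℕ),
      Module.finrank F (Submodule.torsionBy F[X]
        (Module.AEval' (Matrix.toLin' x : Module.End F (N → F))) (φ.1 ^ k)) =
      ∑ i, (if p i = φ then min (e i) k * φ.1.natDegree else 0) := by
    intro φ k
    rw [finrank_torsionBy_congr l, finrank_torsionBy_pi]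
    refine Finset.sum_congr rfl fun i _ => ?_
    rw [finrank_torsionBy_prime _ _ (p i).2.1 (p i).2.2 φ.2.1 φ.2.2]
    simp only [Subtype.ext_iff]
  refine ⟨κ, hκ, p, e, fun φ k => ?_, ?_⟩
  · rw [← map_pow, ← key, rank_add_torsion]
  · rw [finrank_commSub]
    have l2 := LinearEquiv.congrLeft (Module.AEval' (Matrix.toLin' x : Module.End F (N → F))) F[X] l
    rw [(l2.restrictScalars F).finrank_eq, finrank_hom_pi]
    exact Finset.sum_congr rfl fun i _ => key _ _

end

theorem toLinearMap2_mem_skewForms {F : Type} [Field F] {N : Type} [Fintype N] [DecidableEq N]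
    (x M : Matrix N N F) (ε : F) :
    Matrix.toLinearMap₂' F M ∈ skewForms ε (Matrix.toLin' xᵀ) ↔
      Mᵀ = ε • M ∧ x * M = -(M * xᵀ) := by
  have inj : ∀ A B : Matrix N N F, (∀ u v, u ⬝ᵥ A *ᵥ v = u ⬝ᵥ B *ᵥ v) ↔ A = B := by
    intro A B
    constructor
    · intro h
      apply (Matrix.toLinearMap₂' F : Matrix N N F ≃ₗ[F] ((N → F) →ₗ[F] (N → F) →ₗ[F] F)).injective
      refine LinearMap.ext₂ fun u v => ?_
      rw [Matrix.toLinearMap₂'_apply', Matrix.toLinearMap₂'_apply', h]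
    · rintro rfl u v; rfl
  have hmem : Matrix.toLinearMap₂' F M ∈ skewForms ε (Matrix.toLin' xᵀ) ↔
      (∀ u v : N → F, v ⬝ᵥ M *ᵥ u = ε * (u ⬝ᵥ M *ᵥ v)) ∧
        ∀ u v : N → F, (xᵀ *ᵥ u) ⬝ᵥ M *ᵥ v = - (u ⬝ᵥ M *ᵥ (xᵀ *ᵥ v)) := by
    show ((∀ u v, _) ∧ ∀ u v, _) ↔ _
    simp only [Matrix.toLinearMap₂'_apply', Matrix.toLin'_apply]
  rw [hmem, ← inj, ← inj]
  refine and_congr (forall₂_congr fun u v => ?_) (forall₂_congr fun u v => ?_)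
  · have : v ⬝ᵥ M *ᵥ u = u ⬝ᵥ Mᵀ *ᵥ v := by
      rw [Matrix.mulVec_transpose, dotProduct_comm u, Matrix.dotProduct_mulVec]
    rw [this, Matrix.smul_mulVec, dotProduct_smul, smul_eq_mul]
  · have : (xᵀ *ᵥ u) ⬝ᵥ M *ᵥ v = u ⬝ᵥ (x * M) *ᵥ v := by
      rw [Matrix.mulVec_transpose, ← Matrix.dotProduct_mulVec, Matrix.mulVec_mulVec]
    rw [this, Matrix.neg_mulVec, dotProduct_neg, Matrix.mulVec_mulVec]

theorem sympJ_mul_self (F : Type) [Field F] (n : ℕ) : sympJ F n * sympJ F n = -1 := by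
  rw [sympJ, Matrix.fromBlocks_multiply, ← Matrix.fromBlocks_one, Matrix.fromBlocks_neg]
  simp

theorem sympJ_transpose (F : Type) [Field F] (n : ℕ) : (sympJ F n)ᵀ = - sympJ F n := by
  rw [sympJ, Matrix.fromBlocks_transpose, Matrix.fromBlocks_neg]
  simp

/-- Right multiplication by `J` as an equivalence. -/
noncomputable def mulJ (F : Type) [Field F] (n : ℕ) :
    Matrix (Fin n ⊕ Fin n) (Fin n ⊕ Fin n) F ≃ₗ[F] Matrix (Fin n ⊕ Fin n) (Fin n ⊕ Fin n) F where
  toFun y := y * sympJ F n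
  invFun y := - (y * sympJ F n)
  map_add' a b := add_mul _ _ _
  map_smul' a b := Matrix.smul_mul _ _ _
  left_inv y := by
    show - (y * sympJ F n * sympJ F n) = y
    rw [mul_assoc, sympJ_mul_self]; simp
  right_inv y := by
    show - (y * sympJ F n) * sympJ F n = y
    rw [neg_mul, mul_assoc, sympJ_mul_self]; simp

theorem comm_iff_skew {F : Type} [Field F] {n : ℕ}
    (x y : Matrix (Fin n ⊕ Fin n) (Fin n ⊕ Fin n) F)
    (hx : x * sympJ F n = (x * sympJ F n)ᵀ) :
    x * y = y * x ↔ x * (y * sympJ F n) = - (y * sympJ F n * xᵀ) := by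
  have h1 : sympJ F n * xᵀ = - (x * sympJ F n) := by
    rw [hx, Matrix.transpose_mul, sympJ_transpose]; simp
  rw [mul_assoc y, h1, mul_neg, neg_neg, ← mul_assoc, ← mul_assoc]
  exact ((mulJ F n).injective.eq_iff (a := x * y) (b := y * x)).symm

theorem card_eq_skewForms {F : Type} [Field F] [Fintype F] {n : ℕ}
    (x : Matrix (Fin n ⊕ Fin n) (Fin n ⊕ Fin n) F)
    (hx : x * sympJ F n = (x * sympJ F n)ᵀ) :
    Nat.card {y : Matrix (Fin n ⊕ Fin n) (Fin n ⊕ Fin n) F //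
          y * sympJ F n = (y * sympJ F n)ᵀ ∧ x * y = y * x} =
      Fintype.card F ^ Module.finrank F (skewForms (1 : F) (Matrix.toLin' xᵀ)) := by
  let E : Matrix (Fin n ⊕ Fin n) (Fin n ⊕ Fin n) F ≃ₗ[F]
      ((Fin n ⊕ Fin n → F) →ₗ[F] (Fin n ⊕ Fin n → F) →ₗ[F] F) :=
    (mulJ F n).trans (Matrix.toLinearMap₂' F)
  rw [← Nat.card_eq_fintype_card, ← Module.natCard_eq_pow_finrank]
  refine Nat.card_congr (E.toEquiv.subtypeEquiv fun y => ?_)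
  have := toLinearMap2_mem_skewForms x (y * sympJ F n) 1
  rw [one_smul] at this
  rw [comm_iff_skew x y hx]
  refine Iff.trans ?_ this.symm
  exact and_congr eq_comm Iff.rfl

theorem finrank_commSub_eq {F : Type} [Field F] (h2 : (2 : F) ≠ 0) {n : ℕ}
    (x : Matrix (Fin n ⊕ Fin n) (Fin n ⊕ Fin n) F)
    (hx : x * sympJ F n = (x * sympJ F n)ᵀ) :
    Module.finrank F (commSub x) =
      Module.finrank F (skewForms (1 : F) (Matrix.toLin' xᵀ)) +
      Module.finrank F (skewForms (-1 : F) (Matrix.toLin' xᵀ)) := by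
  let E : Matrix (Fin n ⊕ Fin n) (Fin n ⊕ Fin n) F ≃ₗ[F]
      ((Fin n ⊕ Fin n → F) →ₗ[F] (Fin n ⊕ Fin n → F) →ₗ[F] F) :=
    (mulJ F n).trans (Matrix.toLinearMap₂' F)
  have hE : ∀ y (ε : F), E y ∈ skewForms ε (Matrix.toLin' xᵀ) ↔
      (y * sympJ F n)ᵀ = ε • (y * sympJ F n) ∧ x * y = y * x := by
    intro y ε
    rw [comm_iff_skew x y hx]
    exact toLinearMap2_mem_skewForms x (y * sympJ F n) ε
  let T : (skewForms (1 : F) (Matrix.toLin' xᵀ) × skewForms (-1 : F) (Matrix.toLin' xᵀ)) →ₗ[F]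
      commSub x :=
    { toFun := fun B => ⟨E.symm B.1.1 + E.symm B.2.1, by
        have h1 := (hE (E.symm B.1.1) 1).1 (by rw [LinearEquiv.apply_symm_apply]; exact B.1.2)
        have h2 := (hE (E.symm B.2.1) (-1)).1 (by rw [LinearEquiv.apply_symm_apply]; exact B.2.2)
        exact (commSub x).add_mem h1.2 h2.2⟩
      map_add' := fun a b => by
        apply Subtype.ext
        simp only [Prod.fst_add, Prod.snd_add, Submodule.coe_add, map_add]
        abel
      map_smul' := fun a b => by
        apply Subtype.ext
        simp only [Prod.smul_fst, Prod.smul_snd, Submodule.coe_smul, map_smul, smul_add,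
          RingHom.id_apply] }
  have hT : Function.Bijective T := by
    constructor
    · rw [injective_iff_map_eq_zero]
      rintro ⟨⟨A, hA⟩, ⟨B, hB⟩⟩ h0
      have h1 : E.symm A + E.symm B = 0 := congrArg Subtype.val h0
      rw [← map_add, LinearEquiv.map_eq_zero_iff] at h1
      have hA0 : A = 0 := by
        refine LinearMap.ext₂ fun u v => ?_
        have a1 := hA.1 u v
        have b1 := hB.1 u v
        have c1 : A u v + B u v = 0 := LinearMap.congr_fun₂ h1 u v
        have c2 : A v u + B v u = 0 := LinearMap.congr_fun₂ h1 v u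
        have : 2 * A u v = 0 := by linear_combination c1 + c2 - a1 - b1
        exact (mul_eq_zero.1 this).resolve_left h2
      subst hA0
      rw [zero_add] at h1
      subst h1
      rfl
    · rintro ⟨y, hy⟩
      have hc : x * y = y * x := hy
      set M := y * sympJ F n with hM
      have hs : x * M = -(M * xᵀ) := (comm_iff_skew x y hx).1 hc
      have hst : x * Mᵀ = - (Mᵀ * xᵀ) := by
        have := congrArg Matrix.transpose hs
        rw [Matrix.transpose_neg, Matrix.transpose_mul x M, Matrix.transpose_mul M xᵀ,
          Matrix.transpose_transpose] at this
        rw [this, neg_neg]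
      have m1 := (toLinearMap2_mem_skewForms x ((2 : F)⁻¹ • (M + Mᵀ)) 1).2 (by
        constructor
        · rw [Matrix.transpose_smul, Matrix.transpose_add, Matrix.transpose_transpose, one_smul,
            add_comm]
        · rw [Matrix.mul_smul, Matrix.smul_mul, mul_add, add_mul, hst, hs, ← smul_neg]
          congr 1; abel)
      have m2 := (toLinearMap2_mem_skewForms x ((2 : F)⁻¹ • (M - Mᵀ)) (-1)).2 (by
        constructor
        · rw [Matrix.transpose_smul, Matrix.transpose_sub, Matrix.transpose_transpose, neg_smul,
            one_smul, ← smul_neg, neg_sub]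
        · rw [Matrix.mul_smul, Matrix.smul_mul, mul_sub, sub_mul, hst, hs, ← smul_neg]
          congr 1; abel)
      refine ⟨(⟨_, m1⟩, ⟨_, m2⟩), Subtype.ext ?_⟩
      show E.symm _ + E.symm _ = y
      rw [← map_add, LinearEquiv.symm_apply_eq, ← map_add]
      show _ = Matrix.toLinearMap₂' F M
      congr 1
      rw [← smul_add]
      have : M + Mᵀ + (M - Mᵀ) = (2 : F) • M := by rw [two_smul]; abel
      rw [this, smul_smul, inv_mul_cancel₀ h2, one_smul]
  rw [← (LinearEquiv.ofBijective T hT).finrank_eq, Module.finrank_prod]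

theorem alternating_sum_eq (a : ℕ → ℝ) (n : ℕ) :
    ∑ k ∈ Finset.range (2 * n), (-1) ^ k * a k =
      ∑ k ∈ Finset.range (2 * n), if Odd (k + 1) then a k - a (k + 1) else 0 := by
  induction n with
  | zero => simp
  | succ n ih =>
    rw [show 2 * (n + 1) = 2 * n + 1 + 1 by ring, Finset.sum_range_succ, Finset.sum_range_succ,
      Finset.sum_range_succ, Finset.sum_range_succ, ih]
    have h1 : Odd (2 * n + 1) := ⟨n, rfl⟩
    have h2 : ¬ Odd (2 * n + 1 + 1) := by
      rw [Nat.not_odd_iff_even]; exact ⟨n + 1, by ring⟩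
    rw [if_pos h1, if_neg h2, pow_succ, pow_mul]
    simp; ring

theorem sum_range_lt_lt (K a b : ℕ) (ha : a ≤ K) :
    ∑ k ∈ Finset.range K, ((if k < a then (1 : ℝ) else 0) * (if k < b then (1 : ℝ) else 0)) =
      (min a b : ℕ) := by
  have : ∀ k, ((if k < a then (1 : ℝ) else 0) * (if k < b then (1 : ℝ) else 0)) =
      if k < min a b then 1 else 0 := by
    intro k
    by_cases h1 : k < a <;> by_cases h2 : k < b <;> simp [h1, h2]
  simp only [this]
  rw [Finset.sum_boole]
  congr 1
  rw [show Finset.filter (fun k => k < min a b) (Finset.range K) = Finset.range (min a b) by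
    ext k; simp only [Finset.mem_filter, Finset.mem_range]; omega]
  simp

theorem card_centralizer_symplectic
    (q : ℕ) (hq : ∃ p m : ℕ, p.Prime ∧ 0 < m ∧ q = p ^ m) (hodd : Odd q)
    (F : Type) [Field F] [Fintype F] (hF : Fintype.card F = q)
    (n : ℕ) (hn : 1 ≤ n)
    (x : Matrix (Fin n ⊕ Fin n) (Fin n ⊕ Fin n) F)
    (hx : x * sympJ F n = (x * sympJ F n)ᵀ) :
    ∃ e : ℕ,
      2 * (e : ℝ) =
        (∑ k ∈ Finset.range (2 * n),
          if Odd (k + 1) then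
            ((rDiff x Polynomial.X (k + 1) - rDiff x Polynomial.X (k + 2) : ℕ) : ℝ)
          else 0) +
        ∑ᶠ φ : {f : Polynomial F // f.Monic ∧ Irreducible f},
          (1 / (φ.val.natDegree : ℝ)) *
            ∑ k ∈ Finset.range (2 * n), ((rDiff x φ.val (k + 1) : ℝ)) ^ 2 ∧
      Nat.card {y : Matrix (Fin n ⊕ Fin n) (Fin n ⊕ Fin n) F //
          y * sympJ F n = (y * sympJ F n)ᵀ ∧ x * y = y * x} = q ^ e := by
  classical
  have h2 : (2 : F) ≠ 0 := by
    apply Ring.two_ne_zero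
    intro h
    have := FiniteField.even_card_iff_char_two.1 h
    rw [hF] at this
    rw [Nat.odd_iff] at hodd
    omega
  obtain ⟨κ, _, p, e, hrank, hcomm⟩ := centralizer_data x
  have hcard : Fintype.card (Fin n ⊕ Fin n) = 2 * n := by simp; ring
  rw [hcard] at hrank
  have he : ∀ i, e i ≤ 2 * n := by
    intro i
    have h := hrank (p i) (e i)
    have hs := Finset.single_le_sum (s := Finset.univ)
      (f := fun j => if p j = p i then min (e j) (e i) * (p i).1.natDegree else 0)
      (fun _ _ => Nat.zero_le _) (Finset.mem_univ i)
    have hd : 0 < (p i).1.natDegree := (p i).2.2.natDegree_pos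
    simp only [if_true, min_self] at hs
    nlinarith
  -- the rank differences
  have hr : ∀ (φ : {f : Polynomial F // f.Monic ∧ Irreducible f}) k, rDiff x φ.1 (k + 1) =
      ∑ i, if p i = φ then (if k < e i then φ.1.natDegree else 0) else 0 := by
    intro φ k
    have ha := hrank φ k
    have hb := hrank φ (k + 1)
    have hab : ∑ i, (if p i = φ then min (e i) (k + 1) * φ.1.natDegree else 0) =
        ∑ i, (if p i = φ then min (e i) k * φ.1.natDegree else 0) +
        ∑ i, if p i = φ then (if k < e i then φ.1.natDegree else 0) else 0 := by
      rw [← Finset.sum_add_distrib]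
      refine Finset.sum_congr rfl fun i _ => ?_
      split_ifs with h1 h3
      · rw [min_eq_right (by omega : k + 1 ≤ e i), min_eq_right (by omega : k ≤ e i)]; ring
      · rw [min_eq_left (by omega : e i ≤ k + 1), min_eq_left (by omega : e i ≤ k)]; ring
      · rfl
    rw [rDiff, Nat.add_sub_cancel]
    omega
  have hranks : ∀ (φ : {f : Polynomial F // f.Monic ∧ Irreducible f}) k,
      ((rDiff x φ.1 (k + 1) : ℕ) : ℝ) = (Matrix.rank ((Polynomial.aeval x) φ.1 ^ k) : ℝ) -
        Matrix.rank ((Polynomial.aeval x) φ.1 ^ (k + 1)) := by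
    intro φ k
    have hle : Matrix.rank ((Polynomial.aeval x) φ.1 ^ (k + 1)) ≤
        Matrix.rank ((Polynomial.aeval x) φ.1 ^ k) := by
      rw [pow_succ]; exact Matrix.rank_mul_le_left _ _
    rw [rDiff, Nat.add_sub_cancel, Nat.cast_sub hle]
  have hanti : ∀ (φ : {f : Polynomial F // f.Monic ∧ Irreducible f}) k,
      rDiff x φ.1 (k + 2) ≤ rDiff x φ.1 (k + 1) := by
    intro φ k
    rw [hr φ k, hr φ (k + 1)]
    refine Finset.sum_le_sum fun i _ => ?_
    split_ifs <;> omega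
  have hfr : Module.finrank F (Fin n ⊕ Fin n → F) = 2 * n := by rw [Module.finrank_pi, hcard]
  -- the difference
  have hdiff := skewForms_diff h2 (2 * n) (Matrix.toLin' xᵀ) hfr.le
  have hrk : ∀ k, Module.finrank F (LinearMap.range ((Matrix.toLin' xᵀ) ^ k)) =
      Matrix.rank (x ^ k) := by
    intro k
    rw [← Matrix.toLin'_pow, ← Matrix.transpose_pow, ← Matrix.rank_transpose (x ^ k),
      Matrix.rank, Matrix.toLin'_apply']
  simp only [hrk] at hdiff
  let φX : {f : Polynomial F // f.Monic ∧ Irreducible f} :=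
    ⟨Polynomial.X, Polynomial.monic_X, Polynomial.irreducible_X⟩
  have hdiffR : (Module.finrank F (skewForms (1 : F) (Matrix.toLin' xᵀ)) : ℝ) -
      Module.finrank F (skewForms (-1 : F) (Matrix.toLin' xᵀ)) =
      ∑ k ∈ Finset.range (2 * n), (-1) ^ k * ((rDiff x Polynomial.X (k + 1) : ℕ) : ℝ) := by
    have := congrArg (fun z : ℤ => (z : ℝ)) hdiff
    simp only [Int.cast_sub, Int.cast_natCast, Int.cast_sum, Int.cast_mul, Int.cast_pow,
      Int.cast_neg, Int.cast_one] at this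
    rw [this]
    refine Finset.sum_congr rfl fun k _ => ?_
    have h3 := hranks φX k
    simp only [φX, Polynomial.aeval_X] at h3
    rw [h3]
  rw [alternating_sum_eq (fun k => ((rDiff x Polynomial.X (k + 1) : ℕ) : ℝ)) n] at hdiffR
  have hsum := finrank_commSub_eq h2 x hx
  -- the finsum
  let G : κ → ℝ := fun i => ∑ j, if p j = p i then
    ((min (e j) (e i) : ℕ) : ℝ) * (p i).1.natDegree else 0
  have hterm : ∀ φ : {f : Polynomial F // f.Monic ∧ Irreducible f},
      (1 / (φ.val.natDegree : ℝ)) *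
            ∑ k ∈ Finset.range (2 * n), ((rDiff x φ.val (k + 1) : ℝ)) ^ 2 =
      ∑ i, if p i = φ then G i else 0 := by
    intro φ
    have hd : (φ.1.natDegree : ℝ) ≠ 0 := by
      have := φ.2.2.natDegree_pos
      positivity
    have hrr : ∀ k, ((rDiff x φ.1 (k + 1) : ℕ) : ℝ) = φ.1.natDegree *
        ∑ i, (if p i = φ then (1 : ℝ) else 0) * (if k < e i then (1 : ℝ) else 0) := by
      intro k
      rw [hr, Nat.cast_sum, Finset.mul_sum]
      refine Finset.sum_congr rfl fun i _ => ?_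
      split_ifs <;> simp
    have hsq : ∀ k, ((rDiff x φ.1 (k + 1) : ℕ) : ℝ) ^ 2 = φ.1.natDegree * ∑ i, ∑ j,
        φ.1.natDegree * ((if p i = φ then (1 : ℝ) else 0) * (if p j = φ then (1 : ℝ) else 0)) *
          ((if k < e j then (1 : ℝ) else 0) * (if k < e i then (1 : ℝ) else 0)) := by
      intro k
      rw [hrr, mul_pow, pow_two (∑ i, _), Finset.sum_mul_sum, pow_two, mul_assoc]
      congr 1
      rw [Finset.mul_sum]
      refine Finset.sum_congr rfl fun i _ => ?_
      rw [Finset.mul_sum]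
      refine Finset.sum_congr rfl fun j _ => ?_
      ring
    simp only [hsq]
    rw [← Finset.mul_sum, ← mul_assoc, one_div, inv_mul_cancel₀ hd, one_mul, Finset.sum_comm]
    refine Finset.sum_congr rfl fun i _ => ?_
    rw [Finset.sum_comm]
    simp only [← Finset.mul_sum, sum_range_lt_lt _ _ _ (he _)]
    by_cases hi : p i = φ
    · subst hi
      simp only [if_true, G]
      refine Finset.sum_congr rfl fun j _ => ?_
      split_ifs <;> simp; ring
    · simp [hi]
  have hfin : ∑ᶠ φ : {f : Polynomial F // f.Monic ∧ Irreducible f},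
          (1 / (φ.val.natDegree : ℝ)) *
            ∑ k ∈ Finset.range (2 * n), ((rDiff x φ.val (k + 1) : ℝ)) ^ 2 =
      (Module.finrank F (commSub x) : ℝ) := by
    simp only [hterm]
    rw [finsum_eq_sum_of_support_subset (s := Finset.univ.image p)]
    · rw [Finset.sum_comm, hcomm, Nat.cast_sum]
      refine Finset.sum_congr rfl fun i _ => ?_
      rw [Finset.sum_ite_eq, if_pos (Finset.mem_image_of_mem _ (Finset.mem_univ i)), Nat.cast_sum]
      refine Finset.sum_congr rfl fun j _ => ?_
      split_ifs <;> simp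
    · intro φ hφ
      rw [Function.mem_support] at hφ
      obtain ⟨i, -, hi⟩ := Finset.exists_ne_zero_of_sum_ne_zero hφ
      have : p i = φ := by
        by_contra h
        exact hi (if_neg h)
      simp only [Finset.coe_image, Finset.coe_univ, Set.image_univ]
      exact ⟨i, this⟩
  refine ⟨Module.finrank F (skewForms (1 : F) (Matrix.toLin' xᵀ)), ?_, ?_⟩
  · rw [hfin, hsum]
    have ho : (∑ k ∈ Finset.range (2 * n),
          if Odd (k + 1) then
            ((rDiff x Polynomial.X (k + 1) - rDiff x Polynomial.X (k + 2) : ℕ) : ℝ)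
          else 0) = ∑ k ∈ Finset.range (2 * n), if Odd (k + 1) then
            ((rDiff x Polynomial.X (k + 1) : ℕ) : ℝ) - (rDiff x Polynomial.X (k + 1 + 1) : ℕ)
          else 0 := by
      refine Finset.sum_congr rfl fun k _ => ?_
      rw [Nat.cast_sub (hanti φX k)]
    rw [ho, ← hdiffR]
    push_cast
    ring
  · rw [card_eq_skewForms x hx, hF]
end

section
/- Let q be an odd prime power, n ≥ 1, and let λ be a partition of 2n in which every odd part occurs with even multiplicity. Then the number of elements x ∈ sp(2n,q) that are nilpotent of Jordan type λ equals |Sp(2n,q)| / ( q^{(∑_{k ≥ 1} (λ'_k)² + o(λ))/2} · ∏_{i ≥ 1} ∏_{j=1}^{⌊m_i(λ)/2⌋} (1 − q^{−2j}) ). -/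
open Matrix

/-- `|Sp(2n,q)| = q^{n²} ∏_{i=1}^n (q^{2i} - 1)`, as a real number. -/
noncomputable def spOrder (q n : ℕ) : ℝ :=
  (q : ℝ) ^ (n ^ 2) * ∏ i ∈ Finset.range n, ((q : ℝ) ^ (2 * (i + 1)) - 1)

set_option linter.unusedSectionVars false

section NilCount

/-- Cardinality of a total space with constant fibre size. -/
theorem NC_card_fiber {α β : Type*} [Finite α] [Finite β] (f : α → β) (c : ℕ)
    (h : ∀ b, Nat.card {a // f a = b} = c) : Nat.card α = Nat.card β * c := by
  have := Fintype.ofFinite β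
  rw [Nat.card_congr (Equiv.sigmaFiberEquiv f).symm, Nat.card_sigma]
  simp [h, Nat.card_eq_fintype_card]

/-- Full row rank, expressed by a right inverse. -/
def NC_FR {F κ ι : Type*} [Field F] [Fintype ι] [DecidableEq κ] (Y : Matrix κ ι F) : Prop :=
  ∃ Z : Matrix ι κ F, Y * Z = 1

variable {F : Type*} [Field F]
variable {ι κ μ : Type*} [Fintype ι] [Fintype κ] [Fintype μ]
  [DecidableEq ι] [DecidableEq κ] [DecidableEq μ]

theorem NC_FR_iff (Y : Matrix κ ι F) : NC_FR Y ↔ LinearIndependent F Y.row := by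
  constructor
  · rintro ⟨Z, hZ⟩
    rw [← Matrix.vecMul_injective_iff]
    intro a b hab
    have := congrArg (fun v => v ᵥ* Z) hab
    simpa [Matrix.vecMul_vecMul, hZ] using this
  · intro h
    have h1 := h.rank_matrix
    refine (Matrix.mulVec_surjective_iff_exists_right_inverse).1 ?_
    have : LinearMap.range Y.mulVecLin = ⊤ := by
      apply Submodule.eq_top_of_finrank_eq
      rw [Module.finrank_fintype_fun_eq_card]
      exact h1
    exact LinearMap.range_eq_top.1 this

theorem NC_FR_rank {Y : Matrix κ ι F} (h : NC_FR Y) : Y.rank = Fintype.card κ :=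
  ((NC_FR_iff Y).1 h).rank_matrix

theorem NC_extend {Y : Matrix κ (κ ⊕ μ) F} (h : NC_FR Y) :
    ∃ W : Matrix μ (κ ⊕ μ) F, IsUnit (fromRows Y W) := by
  have hl := (NC_FR_iff Y).1 h
  set b := Module.Basis.sumExtend hl with hb
  have hf : Finite (κ ⊕ (Module.Basis.sumExtendIndex hl)) := Module.Finite.finite_basis b
  have hf2 : Finite (Module.Basis.sumExtendIndex hl) := Finite.of_injective (β := κ ⊕ (Module.Basis.sumExtendIndex hl)) Sum.inr Sum.inr_injective
  have := Fintype.ofFinite (Module.Basis.sumExtendIndex hl)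
  have hc := Module.finrank_eq_card_basis b
  rw [Module.finrank_fintype_fun_eq_card, Fintype.card_sum, Fintype.card_sum] at hc
  have hc' : Fintype.card μ = Fintype.card (Module.Basis.sumExtendIndex hl) := by omega
  have e := Fintype.equivOfCardEq hc'
  refine ⟨fun i => b (Sum.inr (e i)), ?_⟩
  rw [← Matrix.linearIndependent_rows_iff_isUnit]
  have hli := b.linearIndependent.comp (Sum.map id e) (by
    intro x y hxy
    rcases x with x | x <;> rcases y with y | y <;> simp_all)
  have hfun : (fromRows Y (fun i => b (Sum.inr (e i)))).row = b ∘ Sum.map id e := by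
    funext i
    rcases i with i | i
    · simp only [Function.comp, Sum.map_inl, id, hb]
      simp [Module.Basis.sumExtend, Equiv.Set.sumDiffSubset_apply_inl]
      rfl
    · rfl
  rw [hfun]
  exact hli

theorem NC_card_FR [Fintype F] (h : Fintype.card κ ≤ Fintype.card ι) :
    Nat.card {Y : Matrix κ ι F // NC_FR Y} =
      ∏ i ∈ Finset.range (Fintype.card κ), (Fintype.card F ^ Fintype.card ι - Fintype.card F ^ i) := by
  have h2 := card_linearIndependent (K := F) (V := ι → F) (k := Fintype.card κ) (by simpa using h)
  rw [Module.finrank_fintype_fun_eq_card] at h2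
  rw [Finset.prod_range, ← h2]
  refine Nat.card_congr ?_
  let e := Fintype.equivFin κ
  refine Equiv.subtypeEquiv (Equiv.arrowCongr e (Equiv.refl (ι → F))) ?_
  intro Y
  rw [NC_FR_iff]
  exact (linearIndependent_equiv e.symm).symm

theorem NC_card_unit [Fintype F] :
    Nat.card {Y : Matrix κ κ F // IsUnit Y} =
      ∏ i ∈ Finset.range (Fintype.card κ), (Fintype.card F ^ Fintype.card κ - Fintype.card F ^ i) := by
  rw [← NC_card_FR (κ := κ) (ι := κ) le_rfl]
  refine Nat.card_congr (Equiv.subtypeEquivRight ?_)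
  intro Y
  rw [NC_FR_iff, Matrix.linearIndependent_rows_iff_isUnit]

theorem NC_rank_unit {A : Matrix κ κ F} : IsUnit A ↔ A.rank = Fintype.card κ := by
  constructor
  · exact Matrix.rank_of_isUnit A
  · intro h
    rw [← Matrix.mulVec_surjective_iff_isUnit]
    have : LinearMap.range A.mulVecLin = ⊤ := by
      apply Submodule.eq_top_of_finrank_eq
      rw [Module.finrank_fintype_fun_eq_card]
      exact h
    exact LinearMap.range_eq_top.1 this

/-- rank is unchanged under congruence-type multiplication by full rank matrices -/
theorem NC_rank_congr {Y : Matrix κ ι F} {X : Matrix ι κ F} {A : Matrix κ κ F}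
    (h : ∃ Z : Matrix ι κ F, Y * Z = 1) (h' : ∃ Z : Matrix κ ι F, Z * X = 1) :
    (X * A * Y).rank = A.rank := by
  obtain ⟨Z, hZ⟩ := h
  obtain ⟨Z', hZ'⟩ := h'
  apply le_antisymm
  · exact (Matrix.rank_mul_le_left _ _).trans (Matrix.rank_mul_le_right _ _)
  · have : A = Z' * (X * A * Y) * Z := by
      calc A = (Z' * X) * A * (Y * Z) := by rw [hZ, hZ']; simp
        _ = _ := by simp only [Matrix.mul_assoc]
    calc A.rank = (Z' * (X * A * Y) * Z).rank := by rw [← this]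
      _ ≤ _ := (Matrix.rank_mul_le_left _ _).trans (Matrix.rank_mul_le_right _ _)

theorem NC_FR_transpose {Y : Matrix κ ι F} (h : NC_FR Y) : ∃ Z : Matrix κ ι F, Z * Yᵀ = 1 := by
  obtain ⟨Z, hZ⟩ := h
  exact ⟨Zᵀ, by rw [← Matrix.transpose_mul, hZ, Matrix.transpose_one]⟩

/-- Decomposition of a rank-`card κ` `ε`-symmetric matrix. -/
theorem NC_decomp {ε : F} (hε : ε * ε = 1) {S : Matrix ι ι F} (hS : Sᵀ = ε • S)
    (hr : S.rank = Fintype.card κ) :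
    ∃ (Y : Matrix κ ι F) (A : Matrix κ κ F), NC_FR Y ∧ Aᵀ = ε • A ∧ IsUnit A ∧ S = Yᵀ * A * Y := by
  have hr' := hr
  rw [Matrix.rank_eq_finrank_span_row] at hr'
  let W := Submodule.span F (Set.range S.row)
  have b : Module.Basis κ F W := by
    have := Module.finBasis F W
    exact this.reindex (Fintype.equivOfCardEq (by rw [Fintype.card_fin]; exact hr'))
  let Y : Matrix κ ι F := fun i => (b i : ι → F)
  have hY : NC_FR Y := by
    rw [NC_FR_iff]
    exact b.linearIndependent.map' W.subtype (Submodule.ker_subtype _)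
  let X : Matrix ι κ F := fun i => b.repr ⟨S i, Submodule.subset_span ⟨i, rfl⟩⟩
  have hX : S = X * Y := by
    ext i j
    have := b.sum_repr ⟨S i, Submodule.subset_span ⟨i, rfl⟩⟩
    have := congrArg (fun w : W => (w : ι → F) j) this
    simp only [Submodule.coe_sum, Submodule.coe_smul, Finset.sum_apply, Pi.smul_apply, smul_eq_mul] at this
    rw [Matrix.mul_apply]
    exact this.symm
  obtain ⟨Z, hZ⟩ := hY
  have hS' : S = Yᵀ * (ε • Xᵀ) := by
    have : S = ε • Sᵀ := by rw [hS, smul_smul, hε, one_smul]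
    rw [Matrix.mul_smul, ← Matrix.transpose_mul, ← hX, ← this]
  have hX' : X = S * Z := by
    rw [hX, Matrix.mul_assoc, hZ, Matrix.mul_one]
  have hZt : Zᵀ * Yᵀ = 1 := by rw [← Matrix.transpose_mul, hZ, Matrix.transpose_one]
  have hfin : S = Yᵀ * (Zᵀ * S * Z) * Y := by
    have h1 : Zᵀ * S = ε • Xᵀ := by
      conv_lhs => rw [hS']
      rw [← Matrix.mul_assoc, hZt, Matrix.one_mul]
    calc S = X * Y := hX
      _ = S * Z * Y := by rw [← hX']
      _ = Yᵀ * (Zᵀ * S) * Z * Y := by rw [h1, ← hS']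
      _ = _ := by simp only [Matrix.mul_assoc]
  refine ⟨Y, Zᵀ * S * Z, ⟨Z, hZ⟩, ?_, ?_, hfin⟩
  · rw [Matrix.transpose_mul, Matrix.transpose_mul, hS, Matrix.transpose_transpose]
    simp [Matrix.mul_assoc]
  · rw [NC_rank_unit]
    rw [← NC_rank_congr (Y := Y) (X := Yᵀ) (A := Zᵀ * S * Z) ⟨Z, hZ⟩ ⟨Zᵀ, hZt⟩, ← hfin, hr]

end NilCount

section NilCount2

variable {F : Type*} [Field F]
variable {ι κ μ α β γ : Type*} [Fintype ι] [Fintype κ] [Fintype μ]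
  [DecidableEq ι] [DecidableEq κ] [DecidableEq μ]
  [Fintype α] [Fintype β] [Fintype γ]
  [DecidableEq α] [DecidableEq β] [DecidableEq γ]

/-- Number of invertible `ε`-symmetric matrices. -/
noncomputable def NC_N (ε : F) (ι : Type*) [Fintype ι] [DecidableEq ι] : ℕ :=
  Nat.card {P : Matrix ι ι F // Pᵀ = ε • P ∧ IsUnit P}

/-- Number of `ε`-symmetric matrices. -/
noncomputable def NC_S (ε : F) (ι : Type*) : ℕ :=
  Nat.card {P : Matrix ι ι F // Pᵀ = ε • P}

/-- Number of invertible `ε`-symmetric completions of a corner `D`. -/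
noncomputable def NC_C (ε : F) (μ : Type*) [Fintype μ] [DecidableEq μ] (D : Matrix κ κ F) : ℕ :=
  Nat.card {X : Matrix μ μ F × Matrix κ μ F //
    X.1ᵀ = ε • X.1 ∧ IsUnit (fromBlocks D X.2 (ε • X.2ᵀ) X.1)}

theorem NC_card_mat [Fintype F] :
    Nat.card (Matrix κ μ F) = Fintype.card F ^ (Fintype.card κ * Fintype.card μ) := by
  change Nat.card (κ → μ → F) = _
  rw [Nat.card_eq_fintype_card, Fintype.card_fun, Fintype.card_fun, ← pow_mul, mul_comm]

theorem NC_N_congr (ε : F) (e : ι ≃ κ) : NC_N ε ι = NC_N ε κ := by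
  refine Nat.card_congr (Equiv.subtypeEquiv (Matrix.reindex e e) ?_)
  intro P
  rw [Matrix.reindex_apply, Matrix.isUnit_submatrix_equiv, Matrix.transpose_submatrix]
  refine and_congr_left fun _ => ⟨fun h => by rw [h]; rfl, fun h => ?_⟩
  exact (Matrix.reindex e e).injective h

theorem NC_isUnit_congr {H P : Matrix ι ι F} (hH : IsUnit H) :
    IsUnit (Hᵀ * P * H) ↔ IsUnit P := by
  rw [hH.mul_right_iff, ((Matrix.isUnit_transpose H).2 hH).mul_left_iff]

theorem NC_sym_congr {ε : F} {H P : Matrix ι ι F} (hH : IsUnit H) :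
    (Hᵀ * P * H)ᵀ = ε • (Hᵀ * P * H) ↔ Pᵀ = ε • P := by
  rw [Matrix.transpose_mul, Matrix.transpose_mul, Matrix.transpose_transpose,
    ← Matrix.mul_assoc, ← Matrix.smul_mul, ← Matrix.mul_smul]
  rw [hH.mul_left_inj, ((Matrix.isUnit_transpose H).2 hH).mul_right_inj]

/-- Congruence as an equivalence on matrices. -/
noncomputable def NC_congrEquiv {H : Matrix ι ι F} (hH : IsUnit H) :
    Matrix ι ι F ≃ Matrix ι ι F where
  toFun P := Hᵀ * P * H
  invFun P := (H⁻¹)ᵀ * P * H⁻¹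
  left_inv P := by
    have h1 : H * H⁻¹ = 1 := Matrix.mul_nonsing_inv H ((Matrix.isUnit_iff_isUnit_det H).1 hH)
    calc (H⁻¹)ᵀ * (Hᵀ * P * H) * H⁻¹ = ((H⁻¹)ᵀ * Hᵀ) * P * (H * H⁻¹) := by
          simp only [Matrix.mul_assoc]
      _ = P := by rw [← Matrix.transpose_mul, h1]; simp
  right_inv P := by
    have h1 : H⁻¹ * H = 1 := Matrix.nonsing_inv_mul H ((Matrix.isUnit_iff_isUnit_det H).1 hH)
    calc Hᵀ * ((H⁻¹)ᵀ * P * H⁻¹) * H = (Hᵀ * (H⁻¹)ᵀ) * P * (H⁻¹ * H) := by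
          simp only [Matrix.mul_assoc]
      _ = P := by rw [← Matrix.transpose_mul, h1]; simp

theorem NC_blocks_sym {ε : F} (hε : ε * ε = 1) {A : Matrix κ κ F} {B : Matrix κ μ F}
    {C : Matrix μ κ F} {D : Matrix μ μ F} :
    (fromBlocks A B C D)ᵀ = ε • fromBlocks A B C D ↔
      Aᵀ = ε • A ∧ C = ε • Bᵀ ∧ Dᵀ = ε • D := by
  rw [Matrix.fromBlocks_transpose, Matrix.fromBlocks_smul, Matrix.fromBlocks_inj]
  constructor
  · rintro ⟨h1, h2, h3, h4⟩
    refine ⟨h1, ?_, h4⟩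
    rw [h3, smul_smul, hε, one_smul]
  · rintro ⟨h1, h2, h4⟩
    refine ⟨h1, ?_, ?_, h4⟩
    · rw [h2]; simp
    · rw [h2, smul_smul, hε, one_smul]

theorem NC_C_eq {ε : F} (hε : ε * ε = 1) {D : Matrix κ κ F} (hD : Dᵀ = ε • D) :
    Nat.card {P : Matrix (κ ⊕ μ) (κ ⊕ μ) F // Pᵀ = ε • P ∧ IsUnit P ∧ P.toBlocks₁₁ = D} =
      NC_C ε μ D := by
  refine Nat.card_congr
    { toFun := fun P => ⟨(P.1.toBlocks₂₂, P.1.toBlocks₁₂), ?_⟩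
      invFun := fun X => ⟨fromBlocks D X.1.2 (ε • X.1.2ᵀ) X.1.1, ?_, X.2.2, by simp⟩
      left_inv := ?_
      right_inv := ?_ }
  · obtain ⟨P, h1, h2, h3⟩ := P
    rw [← fromBlocks_toBlocks P] at h1 h2
    rw [NC_blocks_sym hε] at h1
    refine ⟨h1.2.2, ?_⟩
    rw [h1.2.1, h3] at h2
    exact h2
  · rw [NC_blocks_sym hε]
    exact ⟨hD, rfl, X.2.1⟩
  · rintro ⟨P, h1, h2, h3⟩
    apply Subtype.ext
    dsimp only
    rw [← fromBlocks_toBlocks P, NC_blocks_sym hε] at h1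
    conv_rhs => rw [← fromBlocks_toBlocks P, h1.2.1, h3]
  · rintro ⟨⟨A, B⟩, h1, h2⟩
    simp

theorem NC_C_congr {ε : F} {H D : Matrix κ κ F} (hH : IsUnit H) :
    NC_C ε μ (Hᵀ * D * H) = NC_C ε μ D := by
  symm
  have h1 : Hᵀ * (H⁻¹)ᵀ = 1 := by
    rw [← Matrix.transpose_mul, Matrix.nonsing_inv_mul H ((Matrix.isUnit_iff_isUnit_det H).1 hH),
      Matrix.transpose_one]
  have h2 : (H⁻¹)ᵀ * Hᵀ = 1 := by
    rw [← Matrix.transpose_mul, Matrix.mul_nonsing_inv H ((Matrix.isUnit_iff_isUnit_det H).1 hH),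
      Matrix.transpose_one]
  let e : Matrix κ μ F ≃ Matrix κ μ F :=
    { toFun := fun B => Hᵀ * B
      invFun := fun B => (H⁻¹)ᵀ * B
      left_inv := fun B => by simp only [← Matrix.mul_assoc, h2, Matrix.one_mul]
      right_inv := fun B => by simp only [← Matrix.mul_assoc, h1, Matrix.one_mul] }
  refine Nat.card_congr (Equiv.subtypeEquiv (Equiv.prodCongr (Equiv.refl _) e) ?_)
  rintro ⟨A, B⟩
  refine and_congr_right fun _ => ?_
  have hH' : IsUnit (fromBlocks H 0 0 (1 : Matrix μ μ F)) := by
    rw [Matrix.isUnit_fromBlocks_zero₂₁]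
    exact ⟨hH, isUnit_one⟩
  rw [← NC_isUnit_congr hH']
  simp [Matrix.fromBlocks_transpose, Matrix.fromBlocks_multiply, e]

theorem NC_C_reindex {ε : F} (e : κ ≃ ι) (D : Matrix κ κ F) :
    NC_C ε μ (Matrix.reindex e e D) = NC_C ε μ D := by
  symm
  refine Nat.card_congr (Equiv.subtypeEquiv
    (Equiv.prodCongr (Equiv.refl _) (Matrix.reindex e (Equiv.refl μ))) ?_)
  rintro ⟨A, B⟩
  refine and_congr_right fun _ => ?_
  rw [← Matrix.isUnit_submatrix_equiv (Equiv.sumCongr e (Equiv.refl μ)).symm (Equiv.sumCongr e (Equiv.refl μ)).symm]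
  convert Iff.rfl using 2
  ext i j
  rcases i with i | i <;> rcases j with j | j <;> simp

theorem NC_inv_sym {ε : F} (hε : ε * ε = 1) {A : Matrix κ κ F} (h : Aᵀ = ε • A) (hu : IsUnit A) :
    (A⁻¹)ᵀ = ε • A⁻¹ := by
  have hd := (Matrix.isUnit_iff_isUnit_det A).1 hu
  have h1 : Aᵀ * (A⁻¹)ᵀ = 1 := by
    rw [← Matrix.transpose_mul, Matrix.nonsing_inv_mul A hd, Matrix.transpose_one]
  have h2 : Aᵀ * (ε • A⁻¹) = 1 := by
    rw [h, Matrix.smul_mul, Matrix.mul_smul, smul_smul, hε, Matrix.mul_nonsing_inv A hd, one_smul]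
  exact ((Matrix.isUnit_transpose A).2 hu).mul_left_cancel (h1.trans h2.symm)

theorem NC_schur1 {ε : F} {D0 : Matrix α α F} (hD : IsUnit D0)
    (A : Matrix μ μ F) (B1 : Matrix α μ F) (B2 : Matrix β μ F) :
    IsUnit (fromBlocks (fromBlocks D0 0 0 (0 : Matrix β β F)) (fromRows B1 B2)
      (ε • (fromRows B1 B2)ᵀ) A) ↔
    IsUnit (fromBlocks 0 B2 (ε • B2ᵀ) (A - ε • (B1ᵀ * D0⁻¹ * B1))) := by
  have := hD.invertible
  rw [← Matrix.isUnit_submatrix_equiv (Equiv.sumAssoc α β μ).symm (Equiv.sumAssoc α β μ).symm]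
  have h : (fromBlocks (fromBlocks D0 0 0 (0 : Matrix β β F)) (fromRows B1 B2)
      (ε • (fromRows B1 B2)ᵀ) A).submatrix (Equiv.sumAssoc α β μ).symm (Equiv.sumAssoc α β μ).symm
      = fromBlocks D0 (fromCols 0 B1) (ε • (fromCols 0 B1)ᵀ) (fromBlocks 0 B2 (ε • B2ᵀ) A) := by
    ext i j
    rcases i with i | i | i <;> rcases j with j | j | j <;> simp
  rw [h, Matrix.isUnit_fromBlocks_iff_of_invertible₁₁, Matrix.invOf_eq_nonsing_inv]
  convert Iff.rfl using 2
  rw [Matrix.transpose_fromCols]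
  ext i j
  rcases i with i | i <;> rcases j with j | j <;>
    simp [Matrix.mul_assoc, Matrix.mul_fromCols, Matrix.fromRows_mul]

theorem NC_C_schur [Fintype F] {ε : F} (hε : ε * ε = 1) {D0 : Matrix α α F} (hD : IsUnit D0)
    (hs : D0ᵀ = ε • D0) :
    NC_C ε μ (fromBlocks D0 0 0 (0 : Matrix β β F)) =
      Fintype.card F ^ (Fintype.card α * Fintype.card μ) * NC_C ε μ (0 : Matrix β β F) := by
  have hm : Nat.card (Matrix α μ F) = Fintype.card F ^ (Fintype.card α * Fintype.card μ) := NC_card_mat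
  rw [← hm]
  unfold NC_C
  rw [← Nat.card_prod]
  have key : ∀ B1 : Matrix α μ F, (ε • (B1ᵀ * D0⁻¹ * B1))ᵀ = ε • (ε • (B1ᵀ * D0⁻¹ * B1)) := by
    intro B1
    rw [Matrix.transpose_smul, Matrix.transpose_mul, Matrix.transpose_mul, NC_inv_sym hε hs hD]
    simp [Matrix.mul_assoc]
  refine Nat.card_congr
    { toFun := fun X => (X.1.2.toRows₁,
        ⟨(X.1.1 - ε • (X.1.2.toRows₁ᵀ * D0⁻¹ * X.1.2.toRows₁), X.1.2.toRows₂), ?_⟩)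
      invFun := fun Y => ⟨(Y.2.1.1 + ε • (Y.1ᵀ * D0⁻¹ * Y.1), fromRows Y.1 Y.2.1.2), ?_⟩
      left_inv := ?_
      right_inv := ?_ }
  · obtain ⟨⟨A, B⟩, h1, h2⟩ := X
    rw [← Matrix.fromRows_toRows B, NC_schur1 hD] at h2
    refine ⟨?_, h2⟩
    dsimp only at h1 ⊢
    rw [Matrix.transpose_sub, h1, key, smul_sub]
  · obtain ⟨B1, ⟨A, B2⟩, h1, h2⟩ := Y
    dsimp only at h1 h2 ⊢
    rw [NC_schur1 hD]
    refine ⟨?_, ?_⟩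
    · rw [Matrix.transpose_add, h1, key, smul_add]
    · rw [add_sub_cancel_right]; exact h2
  · rintro ⟨⟨A, B⟩, h1, h2⟩
    simp
  · rintro ⟨B1, ⟨A, B2⟩, h1, h2⟩
    simp

theorem NC_C_rank [Fintype F] {ε : F} (hε : ε * ε = 1) {D : Matrix (α ⊕ β) (α ⊕ β) F}
    (hs : Dᵀ = ε • D) (hr : D.rank = Fintype.card α) :
    NC_C ε μ D =
      Fintype.card F ^ (Fintype.card α * Fintype.card μ) * NC_C ε μ (0 : Matrix β β F) := by
  obtain ⟨Y, A, hY, hA, hu, rfl⟩ := NC_decomp (κ := α) hε hs hr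
  obtain ⟨W, hW⟩ := NC_extend hY
  rw [← NC_C_schur hε hu hA,
    ← NC_C_congr (ε := ε) (μ := μ) (D := fromBlocks A 0 0 (0 : Matrix β β F)) hW]
  congr 1
  rw [Matrix.transpose_fromRows, Matrix.fromCols_mul_fromBlocks, Matrix.fromCols_mul_fromRows]
  simp

theorem NC_C_zero {ε : F} (h : Fintype.card μ < Fintype.card β) :
    NC_C ε μ (0 : Matrix β β F) = 0 := by
  unfold NC_C
  rw [Nat.card_eq_zero]
  left
  constructor
  rintro ⟨⟨A, B⟩, h1, h2⟩
  obtain ⟨Q, hQ⟩ := h2.exists_right_inv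
  rw [← fromBlocks_toBlocks Q, Matrix.fromBlocks_multiply, ← Matrix.fromBlocks_one,
    Matrix.fromBlocks_inj] at hQ
  have h3 := hQ.1
  rw [Matrix.zero_mul, zero_add] at h3
  have h4 := NC_FR_rank ⟨_, h3⟩
  have := Matrix.rank_le_card_width B
  dsimp only at *
  omega

theorem NC_schur2 {ε : F} (hε : ε * ε = 1) 
    (A1 : Matrix β β F) (A2 : Matrix β γ F) (A3 : Matrix γ γ F) :
    IsUnit (fromBlocks (0 : Matrix β β F) (fromCols 1 0) (ε • (fromCols 1 0)ᵀ)
      (fromBlocks A1 A2 (ε • A2ᵀ) A3)) ↔ IsUnit A3 := by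
  rw [← Matrix.isUnit_submatrix_equiv (Equiv.sumAssoc β β γ) (Equiv.sumAssoc β β γ)]
  have h : (fromBlocks (0 : Matrix β β F) (fromCols 1 0) (ε • (fromCols 1 0)ᵀ)
      (fromBlocks A1 A2 (ε • A2ᵀ) A3)).submatrix (Equiv.sumAssoc β β γ) (Equiv.sumAssoc β β γ)
      = fromBlocks (fromBlocks 0 1 (ε • 1) A1) (fromRows 0 A2) (fromCols 0 (ε • A2ᵀ)) A3 := by
    ext i j
    rcases i with (i | i) | i <;> rcases j with (j | j) | j <;> simp [Matrix.one_apply, eq_comm]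
  have hE : fromBlocks 0 1 (ε • (1 : Matrix β β F)) A1 *
      fromBlocks (-(ε • A1)) (ε • 1) 1 0 = 1 := by
    rw [Matrix.fromBlocks_multiply, ← Matrix.fromBlocks_one]
    simp [smul_smul, hε]
  have := invertibleOfRightInverse _ _ hE
  rw [h, Matrix.isUnit_fromBlocks_iff_of_invertible₁₁]
  have h5 : ⅟(fromBlocks 0 1 (ε • (1 : Matrix β β F)) A1) = fromBlocks (-(ε • A1)) (ε • 1) 1 0 :=
    invOf_eq_right_inv hE
  rw [h5, Matrix.fromCols_mul_fromBlocks, Matrix.fromCols_mul_fromRows]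
  simp

theorem NC_C_main [Fintype F] {ε : F} (hε : ε * ε = 1) :
    NC_C ε (β ⊕ γ) (0 : Matrix β β F) =
      Nat.card {Y : Matrix β (β ⊕ γ) F // NC_FR Y} *
        (NC_S ε β * Fintype.card F ^ (Fintype.card β * Fintype.card γ) * NC_N ε γ) := by
  have hm : Nat.card (Matrix β γ F) = Fintype.card F ^ (Fintype.card β * Fintype.card γ) := NC_card_mat
  have hFR : ∀ X : {X : Matrix (β ⊕ γ) (β ⊕ γ) F × Matrix β (β ⊕ γ) F //
    X.1ᵀ = ε • X.1 ∧ IsUnit (fromBlocks (0 : Matrix β β F) X.2 (ε • X.2ᵀ) X.1)}, NC_FR X.1.2 := by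
    rintro ⟨⟨A, B⟩, h1, h2⟩
    obtain ⟨Q, hQ⟩ := h2.exists_right_inv
    rw [← fromBlocks_toBlocks Q, Matrix.fromBlocks_multiply, ← Matrix.fromBlocks_one,
      Matrix.fromBlocks_inj] at hQ
    have h3 := hQ.1
    rw [Matrix.zero_mul, zero_add] at h3
    exact ⟨_, h3⟩
  unfold NC_C
  refine NC_card_fiber (fun X => ⟨X.1.2, hFR X⟩) _ ?_
  rintro ⟨Y, hY⟩
  obtain ⟨W, hW⟩ := NC_extend hY
  set H := fromRows Y W with hH
  have hHY : fromCols (1 : Matrix β β F) (0 : Matrix β γ F) * H = Y := by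
    rw [hH, Matrix.fromCols_mul_fromRows]; simp
  have hH' : IsUnit (fromBlocks (1 : Matrix β β F) 0 0 H) := by
    rw [Matrix.isUnit_fromBlocks_zero₂₁]
    exact ⟨isUnit_one, hW⟩
  rw [← hm]
  unfold NC_S NC_N
  rw [← Nat.card_prod, ← Nat.card_prod]
  have key : ∀ A : Matrix (β ⊕ γ) (β ⊕ γ) F,
      (IsUnit (fromBlocks (0 : Matrix β β F) Y (ε • Yᵀ) (Hᵀ * A * H)) ↔
       IsUnit (fromBlocks (0 : Matrix β β F) (fromCols 1 0) (ε • (fromCols 1 0)ᵀ) A)) := by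
    intro A
    rw [← NC_isUnit_congr (P := fromBlocks (0 : Matrix β β F) (fromCols 1 0) (ε • (fromCols 1 0)ᵀ) A) hH']
    rw [Matrix.fromBlocks_transpose, Matrix.fromBlocks_multiply, Matrix.fromBlocks_multiply]
    rw [← hHY, Matrix.transpose_mul]
    simp
  calc _ = Nat.card {A : Matrix (β ⊕ γ) (β ⊕ γ) F // Aᵀ = ε • A ∧
        IsUnit (fromBlocks (0 : Matrix β β F) Y (ε • Yᵀ) A)} := by
        refine Nat.card_congr
          { toFun := fun X => ⟨X.1.1.1, X.1.2.1, ?_⟩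
            invFun := fun A => ⟨⟨(A.1, Y), A.2⟩, rfl⟩
            left_inv := ?_
            right_inv := ?_ }
        · obtain ⟨⟨⟨A, B⟩, h1, h2⟩, h3⟩ := X
          obtain rfl : B = Y := congrArg Subtype.val h3
          exact h2
        · rintro ⟨⟨⟨A, B⟩, h1, h2⟩, h3⟩
          obtain rfl : B = Y := congrArg Subtype.val h3
          rfl
        · rintro ⟨A, h⟩
          rfl
    _ = Nat.card {A : Matrix (β ⊕ γ) (β ⊕ γ) F // Aᵀ = ε • A ∧
        IsUnit (fromBlocks (0 : Matrix β β F) (fromCols 1 0) (ε • (fromCols 1 0)ᵀ) A)} := by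
        symm
        refine Nat.card_congr (Equiv.subtypeEquiv (NC_congrEquiv hW) ?_)
        intro A
        have e1 : NC_congrEquiv hW A = Hᵀ * A * H := rfl
        rw [e1, key, NC_sym_congr hW]
    _ = _ := by
        refine Nat.card_congr
          { toFun := fun A => ((⟨A.1.toBlocks₁₁, ?_⟩, A.1.toBlocks₁₂), ⟨A.1.toBlocks₂₂, ?_, ?_⟩)
            invFun := fun A => ⟨fromBlocks A.1.1.1 A.1.2 (ε • A.1.2ᵀ) A.2.1, ?_, ?_⟩
            left_inv := ?_
            right_inv := ?_ }
        · obtain ⟨A, h1, h2⟩ := A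
          rw [← fromBlocks_toBlocks A, NC_blocks_sym hε] at h1
          exact h1.1
        · obtain ⟨A, h1, h2⟩ := A
          rw [← fromBlocks_toBlocks A, NC_blocks_sym hε] at h1
          exact h1.2.2
        · obtain ⟨A, h1, h2⟩ := A
          rw [← fromBlocks_toBlocks A, NC_blocks_sym hε] at h1
          rw [← fromBlocks_toBlocks A, h1.2.1, NC_schur2 hε] at h2
          exact h2
        · rw [NC_blocks_sym hε]
          exact ⟨A.1.1.2, rfl, A.2.2.1⟩
        · rw [NC_schur2 hε]
          exact A.2.2.2
        · rintro ⟨A, h1, h2⟩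
          apply Subtype.ext
          dsimp only
          rw [← fromBlocks_toBlocks A, NC_blocks_sym hε] at h1
          conv_rhs => rw [← fromBlocks_toBlocks A, h1.2.1]
        · rintro ⟨⟨⟨A1, h1⟩, A2⟩, ⟨A3, h3⟩⟩
          simp

end NilCount2

section NilCount3

variable {F : Type*} [Field F]
variable {ι κ μ α β γ : Type*} [Fintype ι] [Fintype κ] [Fintype μ]
  [DecidableEq ι] [DecidableEq κ] [DecidableEq μ]
  [Fintype α] [Fintype β] [Fintype γ]
  [DecidableEq α] [DecidableEq β] [DecidableEq γ]

theorem NC_C_reindex_right {ε : F} (e : μ ≃ ι) (D : Matrix κ κ F) :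
    NC_C ε μ D = NC_C ε ι D := by
  refine Nat.card_congr (Equiv.subtypeEquiv
    (Equiv.prodCongr (Matrix.reindex e e) (Matrix.reindex (Equiv.refl κ) e)) ?_)
  rintro ⟨A, B⟩
  refine and_congr ?_ ?_
  · refine ⟨fun h => ?_, fun h => ?_⟩
    · dsimp only at h
      simp only [Equiv.prodCongr_apply, Prod.map, Matrix.reindex_apply, Matrix.transpose_submatrix]
      rw [h]; rfl
    · exact (Matrix.reindex e e).injective h
  rw [← Matrix.isUnit_submatrix_equiv (Equiv.sumCongr (Equiv.refl κ) e).symm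
    (Equiv.sumCongr (Equiv.refl κ) e).symm]
  convert Iff.rfl using 2
  ext i j
  rcases i with i | i <;> rcases j with j | j <;> simp

theorem NC_C_rank' [Fintype F] {ε : F} (hε : ε * ε = 1) {D : Matrix κ κ F} {r m : ℕ}
    (hs : Dᵀ = ε • D) (hr : D.rank = r) (hc : Fintype.card κ = r + m) :
    NC_C ε μ D = Fintype.card F ^ (r * Fintype.card μ) * NC_C ε μ (0 : Matrix (Fin m) (Fin m) F) := by
  have e : κ ≃ Fin r ⊕ Fin m := Fintype.equivOfCardEq (by simpa using hc)
  rw [← NC_C_reindex e D]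
  rw [NC_C_rank (α := Fin r) (β := Fin m) hε]
  · simp
  · rw [Matrix.reindex_apply, Matrix.transpose_submatrix, hs]; rfl
  · rw [Matrix.rank_reindex, hr, Fintype.card_fin]

theorem NC_C_main' [Fintype F] {ε : F} (hε : ε * ε = 1) {m g : ℕ}
    (hc : Fintype.card μ = m + g) :
    NC_C ε μ (0 : Matrix (Fin m) (Fin m) F) =
      (∏ i ∈ Finset.range m, (Fintype.card F ^ (m + g) - Fintype.card F ^ i)) *
        (NC_S ε (Fin m) * Fintype.card F ^ (m * g) * NC_N ε (Fin g)) := by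
  have e : μ ≃ Fin m ⊕ Fin g := Fintype.equivOfCardEq (by simpa using hc)
  rw [NC_C_reindex_right e, NC_C_main hε, NC_card_FR (by simp)]
  simp

theorem NC_fib_aux {Y Y0 : Matrix κ ι F} {Z Z0 : Matrix ι κ F} {A A0 : Matrix κ κ F}
    (hZ : Y * Z = 1) (hZ0 : Y0 * Z0 = 1) (hA : IsUnit A) (h : Yᵀ * A * Y = Y0ᵀ * A0 * Y0) :
    Y * Z0 * Y0 = Y := by
  have hd := (Matrix.isUnit_iff_isUnit_det A).1 hA
  have hZt : Zᵀ * Yᵀ = 1 := by rw [← Matrix.transpose_mul, hZ, Matrix.transpose_one]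
  have h1 : Y = A⁻¹ * Zᵀ * Y0ᵀ * A0 * Y0 := by
    calc Y = (A⁻¹ * ((Zᵀ * Yᵀ) * A)) * Y := by
            rw [hZt, Matrix.one_mul, Matrix.nonsing_inv_mul A hd, Matrix.one_mul]
      _ = A⁻¹ * Zᵀ * (Yᵀ * A * Y) := by simp only [Matrix.mul_assoc]
      _ = _ := by rw [h]; simp only [Matrix.mul_assoc]
  have h2 : Y * Z0 = A⁻¹ * Zᵀ * Y0ᵀ * A0 := by
    conv_lhs => rw [h1]
    rw [Matrix.mul_assoc _ Y0, hZ0, Matrix.mul_one]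
  rw [h2, ← h1]

theorem NC_fib {ε : F} (hε : ε * ε = 1) {S : Matrix ι ι F}
    (hS : Sᵀ = ε • S) (hr : S.rank = Fintype.card κ) :
    Nat.card {X : Matrix κ ι F × Matrix κ κ F //
      NC_FR X.1 ∧ X.2ᵀ = ε • X.2 ∧ IsUnit X.2 ∧ X.1ᵀ * X.2 * X.1 = S} =
    Nat.card {g : Matrix κ κ F // IsUnit g} := by
  obtain ⟨Y0, A0, ⟨Z0, hZ0⟩, hA0, hu0, rfl⟩ := NC_decomp (κ := κ) hε hS hr
  symm
  have hinv : ∀ g : Matrix κ κ F, IsUnit g → g⁻¹ * g = 1 ∧ g * g⁻¹ = 1 := fun g hg =>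
    ⟨Matrix.nonsing_inv_mul g ((Matrix.isUnit_iff_isUnit_det g).1 hg),
     Matrix.mul_nonsing_inv g ((Matrix.isUnit_iff_isUnit_det g).1 hg)⟩
  refine Nat.card_congr (Equiv.ofBijective
    (fun g => ⟨(g.1 * Y0, (g.1⁻¹)ᵀ * A0 * g.1⁻¹), ?_, ?_, ?_, ?_⟩) ⟨?_, ?_⟩)
  · obtain ⟨g, hg⟩ := g
    refine ⟨Z0 * g⁻¹, ?_⟩
    dsimp only
    rw [Matrix.mul_assoc, ← Matrix.mul_assoc Y0, hZ0, Matrix.one_mul, (hinv g hg).2]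
  · obtain ⟨g, hg⟩ := g
    exact (NC_sym_congr (H := g⁻¹) ((Matrix.isUnit_nonsing_inv_iff).2 hg)).2 hA0
  · obtain ⟨g, hg⟩ := g
    exact (NC_isUnit_congr (H := g⁻¹) ((Matrix.isUnit_nonsing_inv_iff).2 hg)).2 hu0
  · obtain ⟨g, hg⟩ := g
    dsimp only
    calc (g * Y0)ᵀ * ((g⁻¹)ᵀ * A0 * g⁻¹) * (g * Y0)
        = Y0ᵀ * (gᵀ * (g⁻¹)ᵀ) * A0 * (g⁻¹ * g) * Y0 := by
          simp only [Matrix.mul_assoc, Matrix.transpose_mul]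
      _ = _ := by rw [← Matrix.transpose_mul, (hinv g hg).1]; simp
  · rintro ⟨g, hg⟩ ⟨g', hg'⟩ h
    have h1 : g * Y0 = g' * Y0 := congrArg (fun x => x.1.1) h
    apply Subtype.ext
    have h2 := congrArg (fun x => x * Z0) h1
    simpa [Matrix.mul_assoc, hZ0] using h2
  · rintro ⟨⟨Y, A⟩, ⟨Z, hZ⟩, hA, hu, hY⟩
    dsimp only at hY hZ hA hu
    have e1 := NC_fib_aux hZ hZ0 hu hY
    have e2 := NC_fib_aux hZ0 hZ hu0 hY.symm
    have e3 : (Y * Z0) * (Y0 * Z) = 1 := by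
      rw [← Matrix.mul_assoc, e1, hZ]
    have hg : IsUnit (Y * Z0) := IsUnit.of_mul_eq_one _ e3
    have e4 : (Y * Z0)⁻¹ = Y0 * Z := Matrix.inv_eq_right_inv e3
    refine ⟨⟨Y * Z0, hg⟩, ?_⟩
    apply Subtype.ext
    dsimp only
    rw [e4, e1]
    refine Prod.ext rfl ?_
    dsimp only
    have hZt : Zᵀ * Yᵀ = 1 := by rw [← Matrix.transpose_mul, hZ, Matrix.transpose_one]
    calc (Y0 * Z)ᵀ * A0 * (Y0 * Z) = Zᵀ * (Y0ᵀ * A0 * Y0) * Z := by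
          simp only [Matrix.mul_assoc, Matrix.transpose_mul]
      _ = (Zᵀ * Yᵀ) * A * (Y * Z) := by rw [← hY]; simp only [Matrix.mul_assoc]
      _ = A := by rw [hZt, hZ]; simp

theorem NC_sym_form {ε : F} {Y : Matrix κ ι F} {A : Matrix κ κ F} (h : Aᵀ = ε • A) :
    (Yᵀ * A * Y)ᵀ = ε • (Yᵀ * A * Y) := by
  rw [Matrix.transpose_mul, Matrix.transpose_mul, Matrix.transpose_transpose, h]
  simp [Matrix.mul_assoc]

theorem NC_rank_form {Y : Matrix κ ι F} {A : Matrix κ κ F} (hY : NC_FR Y) (h : IsUnit A) :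
    (Yᵀ * A * Y).rank = Fintype.card κ := by
  rw [NC_rank_congr hY (NC_FR_transpose hY), NC_rank_unit.1 h]

/-- The number of `ε`-symmetric matrices of given rank. -/
theorem NC_card_rank [Fintype F] {ε : F} (hε : ε * ε = 1) :
    Nat.card {S : Matrix ι ι F // Sᵀ = ε • S ∧ S.rank = Fintype.card κ} *
      Nat.card {g : Matrix κ κ F // IsUnit g} =
    Nat.card {Y : Matrix κ ι F // NC_FR Y} * NC_N ε κ := by
  have h1 : Nat.card {X : Matrix κ ι F × Matrix κ κ F //
      NC_FR X.1 ∧ X.2ᵀ = ε • X.2 ∧ IsUnit X.2} =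
      Nat.card {S : Matrix ι ι F // Sᵀ = ε • S ∧ S.rank = Fintype.card κ} *
      Nat.card {g : Matrix κ κ F // IsUnit g} := by
    refine NC_card_fiber (fun X => ⟨X.1.1ᵀ * X.1.2 * X.1.1, NC_sym_form X.2.2.1,
      NC_rank_form X.2.1 X.2.2.2⟩) _ ?_
    rintro ⟨S, hS, hr⟩
    rw [← NC_fib hε hS hr]
    refine Nat.card_congr
      { toFun := fun X => ⟨X.1.1, X.1.2.1, X.1.2.2.1, X.1.2.2.2, congrArg Subtype.val X.2⟩
        invFun := fun X => ⟨⟨X.1, X.2.1, X.2.2.1, X.2.2.2.1⟩, Subtype.ext X.2.2.2.2⟩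
        left_inv := fun X => rfl
        right_inv := fun X => rfl }
  rw [← h1]
  unfold NC_N
  rw [← Nat.card_prod]
  exact Nat.card_congr
      { toFun := fun X => (⟨X.1.1, X.2.1⟩, ⟨X.1.2, X.2.2⟩)
        invFun := fun X => ⟨(X.1.1, X.2.1), X.1.2, X.2.2⟩
        left_inv := fun X => rfl
        right_inv := fun X => rfl }

theorem NC_C_fiber {ε : F} (hε : ε * ε = 1) {Y : Matrix κ (κ ⊕ μ) F} (hY : NC_FR Y)
    {D : Matrix κ κ F} (hD : Dᵀ = ε • D) :
    Nat.card {P : Matrix (κ ⊕ μ) (κ ⊕ μ) F // Pᵀ = ε • P ∧ IsUnit P ∧ Y * P * Yᵀ = D} =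
      NC_C ε μ D := by
  rw [← NC_C_eq hε hD]
  obtain ⟨W, hW⟩ := NC_extend hY
  have hW' : IsUnit (fromRows Y W)ᵀ := (Matrix.isUnit_transpose _).2 hW
  refine Nat.card_congr (Equiv.subtypeEquiv (NC_congrEquiv hW') ?_)
  intro P
  have e1 : NC_congrEquiv hW' P = (fromRows Y W)ᵀᵀ * P * (fromRows Y W)ᵀ := rfl
  rw [e1, NC_sym_congr hW', NC_isUnit_congr hW']
  refine and_congr_right fun _ => and_congr_right fun _ => ?_
  rw [Matrix.transpose_transpose, Matrix.transpose_fromRows, Matrix.fromRows_mul,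
    Matrix.fromRows_mul_fromCols, Matrix.toBlocks_fromBlocks₁₁]

/-- Number of pairs of forms with prescribed rank sequence of the product. -/
noncomputable def NC_T (ε : F) (ι : Type*) [Fintype ι] [DecidableEq ι] (R : ℕ → ℕ) : ℕ :=
  Nat.card {X : Matrix ι ι F × Matrix ι ι F //
    X.1ᵀ = ε • X.1 ∧ IsUnit X.1 ∧ X.2ᵀ = (-ε) • X.2 ∧ ∀ j, ((X.1 * X.2) ^ j).rank = R j}

theorem NC_pow_aux (U : Matrix ι κ F) (V : Matrix κ ι F) (j : ℕ) :
    (U * V) ^ (j + 1) = U * (V * U) ^ j * V := by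
  induction j with
  | zero => simp
  | succ j ih =>
    rw [pow_succ, ih, pow_succ]
    simp only [Matrix.mul_assoc]

theorem NC_rank_pow {Y : Matrix κ ι F} {A : Matrix κ κ F} {P : Matrix ι ι F}
    (hY : NC_FR Y) (hA : IsUnit A) (hP : IsUnit P) (j : ℕ) :
    ((P * (Yᵀ * A * Y)) ^ (j + 1)).rank = ((A * (Y * P * Yᵀ)) ^ j).rank := by
  have h1 : P * (Yᵀ * A * Y) = (P * Yᵀ) * (A * Y) := by simp only [Matrix.mul_assoc]
  have h2 : A * (Y * P * Yᵀ) = (A * Y) * (P * Yᵀ) := by simp only [Matrix.mul_assoc]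
  rw [h1, h2, NC_pow_aux, ← Matrix.mul_assoc _ A Y, Matrix.mul_assoc _ _ A, NC_rank_congr hY]
  · rw [Matrix.rank_mul_eq_left_of_isUnit_det]
    exact (Matrix.isUnit_iff_isUnit_det A).1 hA
  · obtain ⟨Z, hZ⟩ := NC_FR_transpose hY
    refine ⟨Z * P⁻¹, ?_⟩
    rw [Matrix.mul_assoc, ← Matrix.mul_assoc P⁻¹,
      Matrix.nonsing_inv_mul P ((Matrix.isUnit_iff_isUnit_det P).1 hP), Matrix.one_mul, hZ]

set_option maxHeartbeats 1000000 in
theorem NC_step [Fintype F] {ε : F} (hε : ε * ε = 1) (R : ℕ → ℕ)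
    (h0 : R 0 = Fintype.card κ + Fintype.card μ) (h1 : R 1 = Fintype.card κ) (c : ℕ)
    (hc : ∀ D : Matrix κ κ F, Dᵀ = ε • D → D.rank = R 2 → NC_C ε μ D = c) :
    NC_T ε (κ ⊕ μ) R * Nat.card {g : Matrix κ κ F // IsUnit g} =
      Nat.card {Y : Matrix κ (κ ⊕ μ) F // NC_FR Y} * NC_T (-ε) κ (fun j => R (j + 1)) * c := by
  have hε' : (-ε) * (-ε) = 1 := by rw [neg_mul_neg, hε]
  let X := {X : Matrix κ (κ ⊕ μ) F × Matrix κ κ F × Matrix (κ ⊕ μ) (κ ⊕ μ) F //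
    (NC_FR X.1 ∧ X.2.1ᵀ = (-ε) • X.2.1 ∧ IsUnit X.2.1) ∧ (X.2.2ᵀ = ε • X.2.2 ∧ IsUnit X.2.2) ∧
    ∀ j, ((X.2.2 * (X.1ᵀ * X.2.1 * X.1)) ^ j).rank = R j}
  have e1 : Nat.card X = NC_T ε (κ ⊕ μ) R * Nat.card {g : Matrix κ κ F // IsUnit g} := by
    refine NC_card_fiber (fun X : X => (⟨(X.1.2.2, X.1.1ᵀ * X.1.2.1 * X.1.1),
      X.2.2.1.1, X.2.2.1.2, NC_sym_form X.2.1.2.1, X.2.2.2⟩ :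
      {X : Matrix (κ ⊕ μ) (κ ⊕ μ) F × Matrix (κ ⊕ μ) (κ ⊕ μ) F //
    X.1ᵀ = ε • X.1 ∧ IsUnit X.1 ∧ X.2ᵀ = (-ε) • X.2 ∧ ∀ j, ((X.1 * X.2) ^ j).rank = R j})) _ ?_
    rintro ⟨⟨P, S⟩, hP, hu, hS, hR⟩
    dsimp only at hP hu hS hR
    have hr : S.rank = Fintype.card κ := by
      have := hR 1
      rw [pow_one, Matrix.rank_mul_eq_right_of_isUnit_det] at this
      · rw [this, h1]
      · exact (Matrix.isUnit_iff_isUnit_det P).1 hu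
    rw [← NC_fib hε' hS hr]
    refine Nat.card_congr
      { toFun := fun X => ⟨(X.1.1.1, X.1.1.2.1), X.1.2.1.1, X.1.2.1.2.1, X.1.2.1.2.2,
          congrArg (fun x => x.1.2) X.2⟩
        invFun := fun X => ⟨⟨(X.1.1, X.1.2, P), ⟨X.2.1, X.2.2.1, X.2.2.2.1⟩, ⟨hP, hu⟩, ?_⟩, ?_⟩
        left_inv := ?_
        right_inv := fun X => rfl }
    · dsimp only
      rw [X.2.2.2.2]
      exact hR
    · apply Subtype.ext
      exact Prod.ext rfl X.2.2.2.2
    · rintro ⟨⟨⟨Y, A, P'⟩, h1, h2, h3⟩, h4⟩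
      simp only [Prod.mk.injEq, Subtype.mk.injEq] at h4
      obtain ⟨rfl, _⟩ := h4
      rfl
  have e2 : Nat.card X = Nat.card ({Y : Matrix κ (κ ⊕ μ) F // NC_FR Y} ×
      {X : Matrix κ κ F × Matrix κ κ F // X.1ᵀ = (-ε) • X.1 ∧ IsUnit X.1 ∧ X.2ᵀ = (-(-ε)) • X.2 ∧
        ∀ j, ((X.1 * X.2) ^ j).rank = R (j + 1)}) * c := by
    have p1 : ∀ x : X, (x.1.1 * x.1.2.2 * x.1.1ᵀ)ᵀ = (-(-ε)) • (x.1.1 * x.1.2.2 * x.1.1ᵀ) := by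
      rintro ⟨⟨Y, A, P⟩, ⟨hY, hA, hu⟩, ⟨hP, hPu⟩, hR⟩
      rw [neg_neg]
      have := NC_sym_form (Y := Yᵀ) hP
      rw [Matrix.transpose_transpose] at this
      exact this
    have p2 : ∀ x : X, ∀ j, ((x.1.2.1 * (x.1.1 * x.1.2.2 * x.1.1ᵀ)) ^ j).rank = R (j + 1) := by
      rintro ⟨⟨Y, A, P⟩, ⟨hY, hA, hu⟩, ⟨hP, hPu⟩, hR⟩
      intro j
      dsimp only at *
      rw [← NC_rank_pow hY hu hPu, hR]
    refine NC_card_fiber (fun x : X => (⟨x.1.1, x.2.1.1⟩,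
      ⟨(x.1.2.1, x.1.1 * x.1.2.2 * x.1.1ᵀ), x.2.1.2.1, x.2.1.2.2, p1 x, p2 x⟩)) _ ?_
    · rintro ⟨⟨Y, hY⟩, ⟨⟨A, D⟩, hA, hu, hD, hR⟩⟩
      dsimp only at hA hu hD hR
      rw [neg_neg] at hD
      have hr : D.rank = R 2 := by
        have := hR 1
        rwa [pow_one, Matrix.rank_mul_eq_right_of_isUnit_det] at this
        exact (Matrix.isUnit_iff_isUnit_det A).1 hu
      rw [← hc D hD hr, ← NC_C_fiber hε hY hD]
      refine Nat.card_congr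
        { toFun := fun X => ⟨X.1.1.2.2, X.1.2.2.1.1, X.1.2.2.1.2, ?_⟩
          invFun := fun P => ⟨⟨(Y, A, P.1), ⟨hY, hA, hu⟩, ⟨P.2.1, P.2.2.1⟩, ?_⟩, ?_⟩
          left_inv := ?_
          right_inv := fun X => rfl }
      · obtain ⟨⟨⟨Y', A', P⟩, h1, h2, h3⟩, h4⟩ := X
        simp only [Prod.mk.injEq, Subtype.mk.injEq] at h4
        obtain ⟨rfl, rfl, h5⟩ := h4
        exact h5
      · obtain ⟨P, hP, hPu, hPD⟩ := P
        dsimp only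
        intro j
        rcases j with _ | j
        · rw [pow_zero, Matrix.rank_one, h0, Fintype.card_sum]
        · rw [NC_rank_pow hY hu hPu, hPD, hR]
      · obtain ⟨P, hP, hPu, hPD⟩ := P
        refine Prod.ext rfl (Subtype.ext (Prod.ext rfl hPD))
      · rintro ⟨⟨⟨Y', A', P⟩, h1, h2, h3⟩, h4⟩
        simp only [Prod.mk.injEq, Subtype.mk.injEq] at h4
        obtain ⟨rfl, rfl, _⟩ := h4
        rfl
  rw [← e1, e2, Nat.card_prod]
  rfl

end NilCount3

section NilCount4

/-- `∏_{i<m} (q^k - q^i)`. -/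
noncomputable def NC_I (q : ℝ) (k m : ℕ) : ℝ := ∏ i ∈ Finset.range m, (q ^ k - q ^ i)

/-- order of `GL_n`. -/
noncomputable def NC_G (q : ℝ) (n : ℕ) : ℝ := NC_I q n n

/-- `∏_{j=1}^t (1 - q^{-2j})`. -/
noncomputable def NC_phi (q : ℝ) (t : ℕ) : ℝ :=
  ∏ j ∈ Finset.range t, (1 - q ^ (-(2 * (j + 1) : ℤ)))

theorem NC_G_split (q : ℝ) (m g : ℕ) :
    NC_G q (m + g) = NC_I q (m + g) m * q ^ (m * g) * NC_G q g := by
  unfold NC_G NC_I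
  rw [Finset.prod_range_add, mul_assoc]
  congr 1
  have hpw : q ^ (m * g) = ∏ _i ∈ Finset.range g, q ^ m := by
    rw [Finset.prod_const, Finset.card_range, ← pow_mul]
  rw [hpw, ← Finset.prod_mul_distrib]
  refine Finset.prod_congr rfl fun i _ => ?_
  ring

theorem NC_G_pos {q : ℝ} (hq : 1 < q) (n : ℕ) : 0 < NC_G q n := by
  unfold NC_G NC_I
  refine Finset.prod_pos fun i hi => ?_
  rw [sub_pos]
  exact pow_lt_pow_right₀ hq (Finset.mem_range.1 hi)

theorem NC_G_succ (q : ℝ) (n : ℕ) :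
    NC_G q (n + 1) = (q ^ (n + 1) - 1) * q ^ n * NC_G q n := by
  rw [add_comm n 1, NC_G_split]
  simp [NC_I]

theorem NC_phi_succ {q : ℝ} (hq : 1 < q) (t : ℕ) :
    NC_phi q (t + 1) * q ^ (2 * t + 2) = NC_phi q t * (q ^ (2 * t + 2) - 1) := by
  have h0 : q ≠ 0 := by positivity
  unfold NC_phi
  rw [Finset.prod_range_succ, mul_assoc]
  congr 1
  have h1 : q ^ (-(2 * ((t : ℤ) + 1))) = (q ^ (2 * t + 2))⁻¹ := by
    rw [_root_.zpow_neg]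
    congr 1
  rw [h1, sub_mul, inv_mul_cancel₀ (pow_ne_zero _ h0), one_mul]

theorem NC_phi_pos {q : ℝ} (hq : 1 < q) (t : ℕ) : 0 < NC_phi q t := by
  unfold NC_phi
  refine Finset.prod_pos fun i hi => ?_
  rw [sub_pos]
  exact zpow_lt_one_of_neg₀ hq (by omega)

/-- dimension of the space of symmetric / alternating matrices -/
def NC_sd (b : Bool) (n : ℕ) : ℕ := if b then (n + 1).choose 2 else n.choose 2

/-- sign -/
def NC_sg (F : Type*) [Field F] (b : Bool) : F := if b then 1 else -1

theorem NC_choose_add (K M : ℕ) :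
    (K + M).choose 2 + (K + 1).choose 2 = K * (K + M) + M.choose 2 := by
  induction K with
  | zero => simp
  | succ K ih =>
    have h1 : (K + 1 + M).choose 2 = (K + M) + (K + M).choose 2 := by
      rw [show K + 1 + M = (K + M) + 1 by ring, Nat.choose_succ_succ' _ 1, Nat.choose_one_right]
    have h2 : (K + 1 + 1).choose 2 = (K + 1) + (K + 1).choose 2 := by
      rw [Nat.choose_succ_succ' _ 1, Nat.choose_one_right]
    rw [h1, h2]
    nlinarith

theorem NC_sd_add (b : Bool) (K M : ℕ) :
    NC_sd (!b) (K + M) + NC_sd b K = K * (K + M) + NC_sd (!b) M := by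
  have h1 := NC_choose_add K M
  have h2 : ∀ n, (n + 1).choose 2 = n + n.choose 2 := fun n => by
      rw [Nat.choose_succ_succ' _ 1, Nat.choose_one_right]
  cases b
  · simp only [NC_sd, Bool.not_false, if_true, Bool.false_eq_true, if_false]
    rw [h2] at h1 ⊢
    rw [h2 M]
    omega
  · simpa [NC_sd] using h1

variable {F : Type*} [Field F]
variable {ι κ μ α β γ : Type*} [Fintype ι] [Fintype κ] [Fintype μ]
  [DecidableEq ι] [DecidableEq κ] [DecidableEq μ]

theorem NC_sg_sq (b : Bool) : NC_sg F b * NC_sg F b = 1 := by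
  cases b <;> simp [NC_sg]

theorem NC_sg_not (b : Bool) : - NC_sg F b = NC_sg F (!b) := by
  cases b <;> simp [NC_sg]

theorem NC_S_congr (ε : F) (e : ι ≃ κ) : NC_S ε ι = NC_S ε κ := by
  refine Nat.card_congr (Equiv.subtypeEquiv (Matrix.reindex e e) ?_)
  intro P
  rw [Matrix.reindex_apply, Matrix.transpose_submatrix]
  refine ⟨fun h => by rw [h]; rfl, fun h => ?_⟩
  exact (Matrix.reindex e e).injective h

theorem NC_S_sum [Fintype F] {ε : F} (hε : ε * ε = 1) :
    NC_S ε (κ ⊕ μ) = NC_S ε κ * Fintype.card F ^ (Fintype.card κ * Fintype.card μ) * NC_S ε μ := by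
  rw [← NC_card_mat]
  unfold NC_S
  rw [← Nat.card_prod, ← Nat.card_prod]
  refine Nat.card_congr
    { toFun := fun A => ((⟨A.1.toBlocks₁₁, ?_⟩, A.1.toBlocks₁₂), ⟨A.1.toBlocks₂₂, ?_⟩)
      invFun := fun A => ⟨fromBlocks A.1.1.1 A.1.2 (ε • A.1.2ᵀ) A.2.1, ?_⟩
      left_inv := ?_
      right_inv := ?_ }
  · obtain ⟨A, h1⟩ := A
    rw [← fromBlocks_toBlocks A, NC_blocks_sym hε] at h1
    exact h1.1
  · obtain ⟨A, h1⟩ := A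
    rw [← fromBlocks_toBlocks A, NC_blocks_sym hε] at h1
    exact h1.2.2
  · rw [NC_blocks_sym hε]
    exact ⟨A.1.1.2, rfl, A.2.2⟩
  · rintro ⟨A, h1⟩
    apply Subtype.ext
    dsimp only
    rw [← fromBlocks_toBlocks A, NC_blocks_sym hε] at h1
    conv_rhs => rw [← fromBlocks_toBlocks A, h1.2.1]
  · rintro ⟨⟨⟨A1, h1⟩, A2⟩, ⟨A3, h3⟩⟩
    simp

theorem NC_skew_one (h2 : (2 : F) ≠ 0) {P : Matrix (Fin 1) (Fin 1) F} (h : Pᵀ = (-1 : F) • P) :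
    P = 0 := by
  ext i j
  have := congrFun (congrFun h i) j
  fin_cases i; fin_cases j
  simp at this ⊢
  have h3 : 2 * P 0 0 = 0 := by linear_combination this
  exact (mul_eq_zero.1 h3).resolve_left h2

theorem NC_sym_one (P : Matrix (Fin 1) (Fin 1) F) : Pᵀ = (1 : F) • P := by
  ext i j
  fin_cases i; fin_cases j
  simp

theorem NC_S_one [Fintype F] (h2 : (2 : F) ≠ 0) (b : Bool) :
    NC_S (NC_sg F b) (Fin 1) = if b then Fintype.card F else 1 := by
  unfold NC_S
  cases b
  · simp only [NC_sg, Bool.false_eq_true, if_false]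
    rw [Nat.card_eq_one_iff_unique]
    refine ⟨⟨?_⟩, ⟨⟨0, by simp⟩⟩⟩
    rintro ⟨A, hA⟩ ⟨B, hB⟩
    apply Subtype.ext
    exact (NC_skew_one h2 hA).trans (NC_skew_one h2 hB).symm
  · simp only [NC_sg, if_true]
    rw [Nat.card_congr (Equiv.subtypeUnivEquiv NC_sym_one), NC_card_mat]
    simp

theorem NC_S_zero (ε : F) : NC_S ε (Fin 0) = 1 := by
  unfold NC_S
  rw [Nat.card_eq_one_iff_unique]
  refine ⟨⟨fun a b => Subtype.ext (Subsingleton.elim _ _)⟩, ⟨⟨0, by simp⟩⟩⟩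

theorem NC_S_formula [Fintype F] (h2 : (2 : F) ≠ 0) (b : Bool) (n : ℕ) :
    NC_S (NC_sg F b) (Fin n) = Fintype.card F ^ NC_sd b n := by
  induction n with
  | zero => rw [NC_S_zero]; cases b <;> simp [NC_sd]
  | succ n ih =>
    rw [NC_S_congr (κ := Fin n ⊕ Fin 1) _ finSumFinEquiv.symm, NC_S_sum (NC_sg_sq b), ih,
      NC_S_one h2]
    have h2 : ∀ n, (n + 1).choose 2 = n + n.choose 2 := fun n => by
      rw [Nat.choose_succ_succ' _ 1, Nat.choose_one_right]
    cases b
    · simp [NC_sd, h2 n, pow_add]; ring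
    · simp [NC_sd, h2 (n + 1), pow_add]; ring

theorem NC_N_zero (ε : F) : NC_N ε (Fin 0) = 1 := by
  unfold NC_N
  rw [Nat.card_eq_one_iff_unique]
  refine ⟨⟨fun a b => Subtype.ext (Subsingleton.elim _ _)⟩, ⟨⟨1, by ext i; exact i.elim0, isUnit_one⟩⟩⟩

theorem NC_card_I [Fintype F] (k m : ℕ) (h : m ≤ k) :
    ((∏ i ∈ Finset.range m, (Fintype.card F ^ k - Fintype.card F ^ i) : ℕ) : ℝ) =
      NC_I (Fintype.card F) k m := by
  unfold NC_I
  rw [Nat.cast_prod]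
  refine Finset.prod_congr rfl fun i hi => ?_
  rw [Nat.cast_sub, Nat.cast_pow, Nat.cast_pow]
  exact Nat.pow_le_pow_right Fintype.card_pos ((Finset.mem_range.1 hi).le.trans h)

theorem NC_N_one [Fintype F] (h2 : (2 : F) ≠ 0) (b : Bool) :
    (NC_N (NC_sg F b) (Fin 1) : ℝ) = if b then (Fintype.card F : ℝ) - 1 else 0 := by
  unfold NC_N
  cases b
  · simp only [NC_sg, Bool.false_eq_true, if_false, Nat.cast_eq_zero]
    rw [Nat.card_eq_zero]
    left
    constructor
    rintro ⟨A, hA, hu⟩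
    rw [NC_skew_one h2 hA] at hu
    exact not_isUnit_zero hu
  · simp only [NC_sg, if_true]
    rw [Nat.card_congr (Equiv.subtypeEquivRight (q := fun P : Matrix (Fin 1) (Fin 1) F => IsUnit P)
      (fun P => by simp [NC_sym_one P])), NC_card_unit, Fintype.card_fin, NC_card_I _ _ le_rfl]
    simp [NC_I]

/-- Recursion for the number of nondegenerate forms. -/
theorem NC_N_rec [Fintype F] (h2 : (2 : F) ≠ 0) (b : Bool) (n : ℕ) :
    (NC_N (NC_sg F b) (Fin (n + 2)) : ℝ) =
      (Fintype.card F : ℝ) ^ (n + 1) * NC_N (NC_sg F b) (Fin 1) * NC_N (NC_sg F b) (Fin (n + 1)) +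
      (Fintype.card F : ℝ) ^ n * NC_S (NC_sg F b) (Fin 1) * ((Fintype.card F : ℝ) ^ (n + 1) - 1) *
        NC_N (NC_sg F b) (Fin n) := by
  classical
  set ε := NC_sg F b with hεd
  have hε : ε * ε = 1 := NC_sg_sq b
  set q : ℝ := ((Fintype.card F : ℕ) : ℝ) with hq
  have hq1 : 1 < q := by rw [hq]; exact_mod_cast Fintype.one_lt_card
  -- count by corner
  have hcount : NC_N ε (Fin (n + 2)) =
      ∑ D : {D : Matrix (Fin (n + 1)) (Fin (n + 1)) F // Dᵀ = ε • D}, NC_C ε (Fin 1) D.1 := by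
    rw [NC_N_congr ε (κ := Fin (n + 1) ⊕ Fin 1) finSumFinEquiv.symm]
    have hD : ∀ P : {P : Matrix (Fin (n + 1) ⊕ Fin 1) (Fin (n + 1) ⊕ Fin 1) F // Pᵀ = ε • P ∧ IsUnit P},
        P.1.toBlocks₁₁ᵀ = ε • P.1.toBlocks₁₁ := by
      rintro ⟨P, h1, _⟩
      rw [← fromBlocks_toBlocks P, NC_blocks_sym hε] at h1
      exact h1.1
    unfold NC_N
    let f : {P : Matrix (Fin (n + 1) ⊕ Fin 1) (Fin (n + 1) ⊕ Fin 1) F // Pᵀ = ε • P ∧ IsUnit P} →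
      {D : Matrix (Fin (n + 1)) (Fin (n + 1)) F // Dᵀ = ε • D} := fun P => ⟨_, hD P⟩
    rw [Nat.card_congr (Equiv.sigmaFiberEquiv f).symm, Nat.card_sigma]
    refine Finset.sum_congr rfl ?_
    rintro ⟨D, hDs⟩ _
    rw [← NC_C_eq hε hDs]
    refine Nat.card_congr
      { toFun := fun X => ⟨X.1.1, X.1.2.1, X.1.2.2, congrArg Subtype.val X.2⟩
        invFun := fun X => ⟨⟨X.1, X.2.1, X.2.2.1⟩, Subtype.ext X.2.2.2⟩
        left_inv := fun X => rfl
        right_inv := fun X => rfl }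
  -- values of the corner counts
  set c1 : ℕ := Fintype.card F ^ ((n + 1) * 1) * NC_N ε (Fin 1) with hc1
  set c2 : ℕ := Fintype.card F ^ (n * 1) * ((Fintype.card F ^ 1 - Fintype.card F ^ 0) * NC_S ε (Fin 1)) with hc2
  have hval : ∀ D : {D : Matrix (Fin (n + 1)) (Fin (n + 1)) F // Dᵀ = ε • D},
      NC_C ε (Fin 1) D.1 = (if D.1.rank = n + 1 then c1 else 0) + (if D.1.rank = n then c2 else 0) := by
    rintro ⟨D, hD⟩
    have hle := Matrix.rank_le_card_width D
    rw [Fintype.card_fin] at hle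
    dsimp only
    obtain ⟨m, hm⟩ := Nat.exists_eq_add_of_le hle
    rw [NC_C_rank' (m := m) hε hD rfl (by simpa using hm)]
    rcases m with _ | _ | m
    · rw [if_pos (by omega), if_neg (by omega), NC_C_main' (m := 0) (g := 1) hε (by simp), NC_S_zero]
      have : D.rank = n + 1 := by omega
      simp [this, hc1]
    · rw [if_neg (by omega), if_pos (by omega), NC_C_main' (m := 0 + 1) (g := 0) hε (by simp), NC_N_zero]
      have : D.rank = n := by omega
      simp [this, hc2]
    · rw [if_neg (by omega), if_neg (by omega), NC_C_zero (by simp)]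
      simp
  have hnum : ∀ r, ∑ D : {D : Matrix (Fin (n + 1)) (Fin (n + 1)) F // Dᵀ = ε • D},
      (if D.1.rank = r then 1 else 0) = Nat.card {S : Matrix (Fin (n + 1)) (Fin (n + 1)) F //
        Sᵀ = ε • S ∧ S.rank = Fintype.card (Fin r)} := by
    intro r
    rw [Finset.sum_boole, Nat.cast_id, Fintype.card_fin, ← Fintype.card_subtype, ← Nat.card_eq_fintype_card]
    exact Nat.card_congr (Equiv.subtypeSubtypeEquivSubtypeInter
      (fun S : Matrix (Fin (n + 1)) (Fin (n + 1)) F => Sᵀ = ε • S) (fun S => S.rank = r))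
  have hsum : NC_N ε (Fin (n + 2)) = c1 * Nat.card {S : Matrix (Fin (n + 1)) (Fin (n + 1)) F //
        Sᵀ = ε • S ∧ S.rank = Fintype.card (Fin (n + 1))} + c2 * Nat.card {S : Matrix (Fin (n + 1)) (Fin (n + 1)) F //
        Sᵀ = ε • S ∧ S.rank = Fintype.card (Fin n)} := by
    rw [hcount, Finset.sum_congr rfl (fun D _ => hval D), Finset.sum_add_distrib, ← hnum, ← hnum,
      Finset.mul_sum, Finset.mul_sum]
    simp
  have k1 : Nat.card {S : Matrix (Fin (n + 1)) (Fin (n + 1)) F //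
        Sᵀ = ε • S ∧ S.rank = Fintype.card (Fin (n + 1))} = NC_N ε (Fin (n + 1)) := by
    refine Nat.card_congr (Equiv.subtypeEquivRight fun S => ?_)
    rw [NC_rank_unit]
  have k2 := NC_card_rank (F := F) (ι := Fin (n + 1)) (κ := Fin n) hε
  rw [NC_card_unit, NC_card_FR (by simp), Fintype.card_fin, Fintype.card_fin] at k2
  have k3 := congrArg (Nat.cast : ℕ → ℝ) k2
  rw [Nat.cast_mul, Nat.cast_mul, NC_card_I _ _ le_rfl, NC_card_I _ _ (by omega), ← hq] at k3
  rw [k1] at hsum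
  have k4 := congrArg (Nat.cast : ℕ → ℝ) hsum
  have hqn : ((Fintype.card F ^ 1 - Fintype.card F ^ 0 : ℕ) : ℝ) = q - 1 := by
    rw [Nat.cast_sub (Nat.pow_le_pow_right Fintype.card_pos (by omega))]
    simp [hq]
  rw [k4, hc1, hc2, Nat.cast_add]
  simp only [Nat.cast_mul, hqn, Nat.cast_pow, ← hq, mul_one]
  rw [Fintype.card_fin]
  set X : ℝ := (Nat.card {S : Matrix (Fin (n + 1)) (Fin (n + 1)) F // Sᵀ = ε • S ∧ S.rank = n} : ℝ) with hX
  have e1 := NC_G_split q n 1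
  have e2 := NC_G_succ q n
  have e3 : NC_G q 1 = q - 1 := by simp [NC_G, NC_I]
  rw [e2, e3, mul_one] at e1
  have hqn0 : q ^ n ≠ 0 := by positivity
  have e4 : NC_I q (n + 1) n * (q - 1) = (q ^ (n + 1) - 1) * NC_G q n := by
    apply mul_left_cancel₀ hqn0
    linear_combination -e1
  have e5 : X * (q - 1) = (q ^ (n + 1) - 1) * NC_N ε (Fin n) := by
    apply mul_left_cancel₀ (NC_G_pos hq1 n).ne'
    have k3' : X * NC_G q n = NC_I q (n + 1) n * NC_N ε (Fin n) := k3
    linear_combination (q - 1) * k3' + NC_N ε (Fin n) * e4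
  linear_combination q ^ n * (NC_S ε (Fin 1) : ℝ) * e5

theorem NC_N_formula [Fintype F] (h2 : (2 : F) ≠ 0) (b : Bool) (n : ℕ) (hn : b = false → Even n) :
    (NC_N (NC_sg F b) (Fin n) : ℝ) *
      ((Fintype.card F : ℝ) ^ NC_sd (!b) n * NC_phi (Fintype.card F) (n / 2)) =
      NC_G (Fintype.card F) n := by
  have hrec := fun n => NC_N_rec h2 b n
  have h1 := NC_N_one h2 b
  have h0 := NC_N_zero (NC_sg F b)
  have hs := NC_S_one h2 b
  set q : ℝ := ((Fintype.card F : ℕ) : ℝ) with hq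
  have hq1 : 1 < q := by rw [hq]; exact_mod_cast Fintype.one_lt_card
  have hq0 : q ≠ 0 := by positivity
  have hch : ∀ n, (n + 1).choose 2 = n + n.choose 2 := fun n => by
      rw [Nat.choose_succ_succ' _ 1, Nat.choose_one_right]
  have hG0 : NC_G q 0 = 1 := by simp [NC_G, NC_I]
  have hp0 : NC_phi q 0 = 1 := by simp [NC_phi]
  cases b
  · -- alternating
    have key : ∀ t : ℕ, (NC_N (NC_sg F false) (Fin (2 * t)) : ℝ) *
      (q ^ NC_sd true (2 * t) * NC_phi q t) = NC_G q (2 * t) := by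
      intro t
      induction t with
      | zero => 
        rw [hG0, hp0, Nat.mul_zero, h0]; simp [NC_sd]
      | succ t ih =>
        have hr := hrec (2 * t)
        rw [h1, hs] at hr
        simp only [Bool.false_eq_true, if_false, mul_zero, zero_mul, zero_add, Nat.cast_one, mul_one] at hr
        rw [show 2 * (t + 1) = 2 * t + 2 by ring, hr, NC_G_succ, NC_G_succ, ← ih]
        have hsd : NC_sd true (2 * t + 2) = NC_sd true (2 * t) + (2 * t + 1) + (2 * t + 2) := by
          simp only [NC_sd, if_true]
          rw [hch (2 * t + 2), hch (2 * t + 1)]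
          ring
        rw [hsd, pow_add, pow_add]
        have hp := NC_phi_succ hq1 t
        linear_combination (q ^ (2 * t) * (q ^ (2 * t + 1) - 1) * NC_N (NC_sg F false) (Fin (2 * t)) *
          q ^ NC_sd true (2 * t) * q ^ (2 * t + 1)) * hp
    obtain ⟨t, rfl⟩ := hn rfl
    have := key t
    rw [← two_mul, Nat.mul_div_cancel_left _ two_pos]
    exact this
  · have hN1 : (NC_N (NC_sg F true) (Fin 1) : ℝ) = q - 1 := by rw [h1]; simp
    have hS1 : (NC_S (NC_sg F true) (Fin 1) : ℝ) = q := by rw [hs]; simp [hq]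
    simp only [hN1, hS1] at hrec
    have hsd : ∀ n, NC_sd false (n + 1) = n + NC_sd false n := by
      intro n
      simp only [NC_sd, Bool.false_eq_true, if_false]
      exact hch n
    have key : ∀ t : ℕ, (NC_N (NC_sg F true) (Fin (2 * t)) : ℝ) *
      (q ^ NC_sd false (2 * t) * NC_phi q t) = NC_G q (2 * t) ∧ 
      (NC_N (NC_sg F true) (Fin (2 * t + 1)) : ℝ) =
        (q ^ (2 * t + 1) - 1) * NC_N (NC_sg F true) (Fin (2 * t)) := by
      intro t
      induction t with
      | zero => 
        refine ⟨?_, ?_⟩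
        · rw [hG0, hp0, Nat.mul_zero, h0]; simp [NC_sd]
        · rw [Nat.mul_zero, h0, zero_add, hN1]; simp
      | succ t ih =>
        obtain ⟨i1, i2⟩ := ih
        have r1 := hrec (2 * t)
        have r2 := hrec (2 * t + 1)
        have hp := NC_phi_succ hq1 t
        have j1 : (NC_N (NC_sg F true) (Fin (2 * t + 2)) : ℝ) =
          q ^ (2 * t + 2) * NC_N (NC_sg F true) (Fin (2 * t + 1)) := by
          rw [r1, i2]; ring
        rw [show 2 * (t + 1) = 2 * t + 2 by ring]
        refine ⟨?_, ?_⟩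
        · rw [j1, i2, NC_G_succ, NC_G_succ, ← i1, hsd, hsd, pow_add, pow_add]
          linear_combination ((q ^ (2 * t + 1) - 1) * NC_N (NC_sg F true) (Fin (2 * t)) *
            q ^ NC_sd false (2 * t) * q ^ (2 * t + 1) * q ^ (2 * t)) * hp
        · rw [show 2 * t + 2 + 1 = 2 * t + 1 + 2 by ring, r2, j1]; ring
    rcases Nat.even_or_odd' n with ⟨t, rfl | rfl⟩
    · rw [Nat.mul_div_cancel_left _ two_pos]
      exact (key t).1
    · have : (2 * t + 1) / 2 = t := by omega
      rw [this, (key t).2, NC_G_succ, ← (key t).1]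
      simp only [Bool.not_true]
      rw [hsd, pow_add]
      ring

end NilCount4

section NilCount5

variable {F : Type*} [Field F]
variable {ι κ μ : Type*} [Fintype ι] [Fintype κ] [Fintype μ]
  [DecidableEq ι] [DecidableEq κ] [DecidableEq μ]

theorem NC_T_congr (ε : F) (e : ι ≃ κ) (R : ℕ → ℕ) : NC_T ε ι R = NC_T ε κ R := by
  have hmul : ∀ A B : Matrix ι ι F, Matrix.reindex e e (A * B) =
      Matrix.reindex e e A * Matrix.reindex e e B := fun A B =>
    map_mul (Matrix.reindexAlgEquiv F F e) A B
  have hpow : ∀ (A : Matrix ι ι F) (j : ℕ), (Matrix.reindex e e A) ^ j =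
      Matrix.reindex e e (A ^ j) := fun A j =>
    (map_pow (Matrix.reindexAlgEquiv F F e) A j).symm
  have hsym : ∀ (ε : F) (A : Matrix ι ι F), Aᵀ = ε • A ↔
      (Matrix.reindex e e A)ᵀ = ε • Matrix.reindex e e A := by
    intro ε A
    rw [Matrix.reindex_apply, Matrix.transpose_submatrix]
    refine ⟨fun h => by rw [h]; rfl, fun h => ?_⟩
    exact (Matrix.reindex e e).injective h
  refine Nat.card_congr (Equiv.subtypeEquiv
    (Equiv.prodCongr (Matrix.reindex e e) (Matrix.reindex e e)) ?_)
  rintro ⟨P, S⟩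
  simp only [Equiv.prodCongr_apply, Prod.map]
  rw [← hsym, ← hsym]
  refine and_congr Iff.rfl (and_congr ?_ (and_congr Iff.rfl ?_))
  · rw [NC_rank_unit, NC_rank_unit, Matrix.rank_reindex, Fintype.card_congr e]
  · refine forall_congr' fun j => ?_
    rw [← hmul, hpow, Matrix.rank_reindex]

/-- the weight attached to a chain of ranks -/
noncomputable def NC_W (q : ℝ) : ℕ → Bool → (ℕ → ℕ) → (ℕ → ℕ) → ℝ
  | 0, _, _, _ => 1
  | L + 1, b, K, M => q ^ NC_sd (!b) (K 0) * NC_phi q (M 0 / 2) *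
      NC_W q L (!b) (fun i => K (i + 1)) (fun i => M (i + 1))

theorem NC_T_zero (ε : F) (R : ℕ → ℕ) (hR : ∀ j, R j = 0) : NC_T ε (Fin 0) R = 1 := by
  unfold NC_T
  rw [Nat.card_eq_one_iff_unique]
  refine ⟨⟨fun a b => Subtype.ext (Subsingleton.elim _ _)⟩, ⟨⟨(1, 0), ?_, isUnit_one, ?_, ?_⟩⟩⟩
  · ext i; exact i.elim0
  · ext i; exact i.elim0
  · intro j
    rw [hR]
    have := Matrix.rank_le_card_width (((1 : Matrix (Fin 0) (Fin 0) F), (0 : Matrix (Fin 0) (Fin 0) F)).1 * (0 : Matrix (Fin 0) (Fin 0) F)) 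
    exact Nat.le_zero.1 ((Matrix.rank_le_card_width _).trans (by simp))

theorem NC_T_formula [Fintype F] (h2 : (2 : F) ≠ 0) (L : ℕ) : ∀ (b : Bool) (R K M : ℕ → ℕ),
    (∀ j, R j = R (j + 1) + K j) → (∀ j, K j = K (j + 1) + M j) → R L = 0 →
    (∀ i, (not^[i] b) = false → Even (M i)) →
    (NC_T (NC_sg F b) (Fin (R 0)) R : ℝ) * NC_W (Fintype.card F) L b K M =
      NC_G (Fintype.card F) (R 0) := by
  have hq1 : (1 : ℝ) < (Fintype.card F : ℝ) := by exact_mod_cast Fintype.one_lt_card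
  induction L with
  | zero =>
    intro b R K M hR hK hL hM
    have hz : ∀ j, R j = 0 := by
      intro j
      induction j with
      | zero => exact hL
      | succ j ih => have := hR j; omega
    rw [hL, NC_T_zero _ _ hz]
    simp [NC_W, NC_G, NC_I]
  | succ L ih =>
    intro b R K M hR hK hL hM
    have hε : NC_sg F b * NC_sg F b = 1 := NC_sg_sq b
    have hR0 := hR 0
    have hR1 := hR 1
    have hK0 := hK 0
    simp only [zero_add] at hR0 hK0
    have hi := ih (!b) (fun j => R (j + 1)) (fun j => K (j + 1)) (fun j => M (j + 1))
      (fun j => hR (j + 1)) (fun j => hK (j + 1)) hL (fun i h => hM (i + 1) h)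
    simp only [zero_add] at hi
    have hst := NC_step (κ := Fin (R 1)) (μ := Fin (K 0)) hε R (by simpa using hR0) (by simp)
      (Fintype.card F ^ (R 2 * K 0) * ((∏ i ∈ Finset.range (K 1), (Fintype.card F ^ (K 1 + M 0) - Fintype.card F ^ i)) *
        (NC_S (NC_sg F b) (Fin (K 1)) * Fintype.card F ^ (K 1 * M 0) * NC_N (NC_sg F b) (Fin (M 0)))))
      (by
        intro D hD hr
        rw [NC_C_rank' (m := K 1) hε hD hr (by simpa using hR1), NC_C_main' (g := M 0) hε (by simpa using hK0)]
        simp)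
    have e : Fin (R 0) ≃ Fin (R 1) ⊕ Fin (K 0) := Fintype.equivOfCardEq (by simpa using hR0)
    rw [← NC_T_congr _ e, NC_sg_not, NC_card_unit, NC_card_FR (by simp), NC_S_formula h2] at hst
    simp only [Fintype.card_sum, Fintype.card_fin] at hst
    have hst' := congrArg (Nat.cast : ℕ → ℝ) hst
    simp only [Nat.cast_mul] at hst'
    rw [NC_card_I _ _ le_rfl, NC_card_I _ _ (by omega), NC_card_I _ _ (by omega)] at hst'
    simp only [Nat.cast_pow] at hst'
    have hN := NC_N_formula h2 b (M 0) (hM 0)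
    have hG1 := NC_G_split (Fintype.card F) (R 1) (K 0)
    have hG2 := NC_G_split (Fintype.card F) (K 1) (M 0)
    have hsd := NC_sd_add b (K 1) (M 0)
    rw [← hR0] at hG1 hst'
    rw [← hK0] at hG2 hst' hsd
    have hW : NC_W (Fintype.card F) (L + 1) b K M = (Fintype.card F : ℝ) ^ NC_sd (!b) (K 0) *
      NC_phi (Fintype.card F) (M 0 / 2) *
      NC_W (Fintype.card F) L (!b) (fun i => K (i + 1)) (fun i => M (i + 1)) := rfl
    rw [hW]
    set q : ℝ := ((Fintype.card F : ℕ) : ℝ) with hq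
    set T : ℝ := (NC_T (NC_sg F b) (Fin (R 0)) R : ℝ)
    set T' : ℝ := (NC_T (NC_sg F (!b)) (Fin (R 1)) (fun j => R (j + 1)) : ℝ)
    set w := NC_W q L (!b) (fun i => K (i + 1)) (fun i => M (i + 1))
    change T * NC_G q (R 1) = _ at hst'
    apply mul_left_cancel₀ (NC_G_pos hq1 (R 1)).ne'
    have hexp : q ^ (R 2 * K 0) * q ^ NC_sd b (K 1) * q ^ NC_sd (!b) (K 0) =
        q ^ (R 1 * K 0) * q ^ NC_sd (!b) (M 0) := by
      rw [← pow_add, ← pow_add, ← pow_add]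
      congr 1
      simp only [Nat.reduceAdd] at hR1
      rw [hR1, add_mul]
      omega
    calc NC_G q (R 1) * (T * (q ^ NC_sd (!b) (K 0) * NC_phi q (M 0 / 2) * w))
        = (T * NC_G q (R 1)) * (q ^ NC_sd (!b) (K 0) * NC_phi q (M 0 / 2) * w) := by ring
      _ = NC_I q (R 0) (R 1) * (T' * w) * (q ^ (R 2 * K 0) * q ^ NC_sd b (K 1) * q ^ NC_sd (!b) (K 0)) *
          NC_I q (K 0) (K 1) * q ^ (K 1 * M 0) * NC_N (NC_sg F b) (Fin (M 0)) * NC_phi q (M 0 / 2) := by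
          rw [hst']; ring
      _ = NC_I q (R 0) (R 1) * NC_G q (R 1) * q ^ (R 1 * K 0) * (NC_I q (K 0) (K 1) * q ^ (K 1 * M 0) *
          (NC_N (NC_sg F b) (Fin (M 0)) * (q ^ NC_sd (!b) (M 0) * NC_phi q (M 0 / 2)))) := by
          rw [hi, hexp]; ring
      _ = NC_G q (R 1) * NC_G q (R 0) := by
          rw [hN, ← hG2, hG1]; ring

end NilCount5

section NilCount6

variable {F : Type*} [Field F]
variable {ι κ μ : Type*} [Fintype ι] [Fintype κ] [Fintype μ]
  [DecidableEq ι] [DecidableEq κ] [DecidableEq μ]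

/-- congruence of bilinear forms -/
def NC_Cong (P Q : Matrix ι ι F) : Prop := ∃ g : Matrix ι ι F, IsUnit g ∧ gᵀ * P * g = Q

theorem NC_Cong_trans {P Q S : Matrix ι ι F} (h1 : NC_Cong P Q) (h2 : NC_Cong Q S) :
    NC_Cong P S := by
  obtain ⟨g, hg, rfl⟩ := h1
  obtain ⟨h, hh, rfl⟩ := h2
  refine ⟨g * h, hg.mul hh, ?_⟩
  simp only [Matrix.transpose_mul, Matrix.mul_assoc]

theorem NC_Cong_symm {P Q : Matrix ι ι F} (h1 : NC_Cong P Q) : NC_Cong Q P := by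
  obtain ⟨g, hg, rfl⟩ := h1
  have hd := (Matrix.isUnit_iff_isUnit_det g).1 hg
  refine ⟨g⁻¹, ?_, ?_⟩
  · rw [Matrix.isUnit_iff_isUnit_det]
    exact Matrix.isUnit_nonsing_inv_det g hd
  · exact (NC_congrEquiv hg).left_inv P

theorem NC_Cong_reindex {P Q : Matrix ι ι F} (e : ι ≃ κ)
    (h : NC_Cong (Matrix.reindex e e P) (Matrix.reindex e e Q)) : NC_Cong P Q := by
  obtain ⟨g, hg, h⟩ := h
  refine ⟨Matrix.reindex e.symm e.symm g, ?_, ?_⟩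
  · rw [NC_rank_unit] at hg ⊢
    rw [Matrix.rank_reindex, hg, Fintype.card_congr e]
  · have h1 : P = Matrix.reindex e.symm e.symm (Matrix.reindex e e P) := by
      ext i j; simp
    apply (Matrix.reindex e e).injective
    rw [← h]
    ext i j
    simp [Matrix.mul_apply, Matrix.submatrix_apply]
    have hs : ∀ f : κ → F, ∑ x : ι, f (e x) = ∑ x, f x := fun f => Equiv.sum_comp e f
    rw [← hs]
    refine Finset.sum_congr rfl fun x _ => ?_
    rw [← hs]
    simp

theorem NC_skew_form (h2 : (2 : F) ≠ 0) {P : Matrix ι ι F} (hP : Pᵀ = (-1 : F) • P) (x y : ι → F) :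
    x ⬝ᵥ P *ᵥ y = - (y ⬝ᵥ P *ᵥ x) := by
  rw [Matrix.dotProduct_mulVec, ← Matrix.mulVec_transpose, hP, dotProduct_comm]
  simp [Matrix.neg_mulVec]

theorem NC_Cong_split (h2 : (2 : F) ≠ 0) {P : Matrix (Fin 2 ⊕ μ) (Fin 2 ⊕ μ) F}
    (hP : Pᵀ = (-1 : F) • P) (hu : IsUnit P) :
    ∃ P' : Matrix μ μ F, P'ᵀ = (-1 : F) • P' ∧ IsUnit P' ∧
      NC_Cong P (fromBlocks !![0, 1; -1, 0] 0 0 P') := by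
  have hd := (Matrix.isUnit_iff_isUnit_det P).1 hu
  set u : Fin 2 ⊕ μ → F := Pi.single (Sum.inl 0) 1 with hudef
  set v : Fin 2 ⊕ μ → F := P⁻¹ *ᵥ u with hv
  have huv : u ⬝ᵥ P *ᵥ v = 1 := by
    rw [hv, Matrix.mulVec_mulVec, Matrix.mul_nonsing_inv P hd, Matrix.one_mulVec]
    simp [hudef]
  have hvu : v ⬝ᵥ P *ᵥ u = -1 := by rw [NC_skew_form h2 hP, huv]
  have hzero : ∀ x : Fin 2 ⊕ μ → F, x ⬝ᵥ P *ᵥ x = 0 := by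
    intro x
    have h3 := NC_skew_form h2 hP x x
    have h4 : 2 * (x ⬝ᵥ P *ᵥ x) = 0 := by linear_combination h3
    exact (mul_eq_zero.1 h4).resolve_left h2
  set J1 : Matrix (Fin 2) (Fin 2) F := !![0, 1; -1, 0] with hJ1
  let Y : Matrix (Fin 2) (Fin 2 ⊕ μ) F := Matrix.of ![u, v]
  have hY : Y * P * Yᵀ = J1 := by
    have hent : ∀ i j, (Y * P * Yᵀ) i j = Y i ⬝ᵥ P *ᵥ Y j := by
      intro i j
      rw [Matrix.mul_assoc]
      rfl
    ext i j
    rw [hent]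
    fin_cases i <;> fin_cases j
    · exact hzero u
    · exact huv
    · exact hvu
    · exact hzero v
  have hJJ : J1 * (-J1) = 1 := by
    rw [hJ1]
    ext i j
    fin_cases i <;> fin_cases j <;> simp [Matrix.mul_apply, Fin.sum_univ_two]
  have hFR : NC_FR Y := ⟨P * Yᵀ * (-J1), by
    rw [← Matrix.mul_assoc, ← Matrix.mul_assoc, hY, hJJ]⟩
  obtain ⟨W, hW⟩ := NC_extend hFR
  have hJs : J1ᵀ = -J1 := by
    rw [hJ1]
    ext i j
    fin_cases i <;> fin_cases j <;> simp
  set B := Y * P * Wᵀ with hB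
  set D := W * P * Wᵀ with hD
  have hH : fromRows Y W * P * (fromRows Y W)ᵀ = fromBlocks J1 B (-Bᵀ) D := by
    rw [Matrix.transpose_fromRows, Matrix.fromRows_mul, Matrix.fromRows_mul_fromCols, hY]
    congr 1
    rw [hB, Matrix.transpose_mul, Matrix.transpose_mul, Matrix.transpose_transpose, hP]
    simp [Matrix.mul_assoc]
  set C : Matrix μ (Fin 2) F := -(Bᵀ * J1) with hC
  have hL : IsUnit (fromBlocks 1 0 C 1 : Matrix (Fin 2 ⊕ μ) (Fin 2 ⊕ μ) F) := by
    rw [Matrix.isUnit_iff_isUnit_det, Matrix.det_fromBlocks_zero₁₂]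
    simp
  have hC1 : C * J1 + (-Bᵀ) = 0 := by
    have : J1 * J1 = -1 := by rw [← hJJ]; simp
    rw [hC, Matrix.neg_mul, Matrix.mul_assoc, this]; simp
  have hC2 : J1 * Cᵀ + B = 0 := by
    rw [hC, Matrix.transpose_neg, Matrix.transpose_mul, Matrix.transpose_transpose, hJs,
      ← Matrix.neg_mul, neg_neg, ← Matrix.mul_assoc]
    have : J1 * J1 = -1 := by rw [← hJJ]; simp
    rw [this]; simp
  have hfin : (fromBlocks 1 0 C 1) * fromBlocks J1 B (-Bᵀ) D * (fromBlocks 1 0 C 1)ᵀ =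
      fromBlocks J1 0 0 (C * B + D) := by
    rw [Matrix.fromBlocks_transpose, Matrix.fromBlocks_multiply, Matrix.fromBlocks_multiply]
    simp only [Matrix.transpose_one, Matrix.transpose_zero, Matrix.one_mul, Matrix.zero_mul,
      add_zero, Matrix.mul_one, Matrix.mul_zero, hC1, hC2, zero_add]
  have hcong : NC_Cong P (fromBlocks J1 0 0 (C * B + D)) := by
    refine ⟨(fromBlocks 1 0 C 1 * fromRows Y W)ᵀ, (Matrix.isUnit_transpose _).2 (hL.mul hW), ?_⟩
    rw [← hfin, ← hH]
    simp only [Matrix.transpose_mul, Matrix.transpose_transpose, Matrix.mul_assoc]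
  refine ⟨C * B + D, ?_, ?_, hcong⟩
  · obtain ⟨g, hg, h⟩ := hcong
    have h3 := (NC_sym_congr (ε := (-1 : F)) hg).2 hP
    rw [h, NC_blocks_sym (by simp)] at h3
    exact h3.2.2
  · obtain ⟨g, hg, h⟩ := hcong
    have h3 := (NC_isUnit_congr hg).2 hu
    rw [h, Matrix.isUnit_iff_isUnit_det, Matrix.det_fromBlocks_zero₁₂] at h3
    rw [Matrix.isUnit_iff_isUnit_det]
    exact isUnit_of_mul_isUnit_right h3

theorem NC_Cong_all (h2 : (2 : F) ≠ 0) : ∀ (m : ℕ) (P Q : Matrix (Fin m) (Fin m) F),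
    Pᵀ = (-1 : F) • P → IsUnit P → Qᵀ = (-1 : F) • Q → IsUnit Q → NC_Cong P Q
  | 0, P, Q, _, _, _, _ => ⟨1, isUnit_one, Subsingleton.elim _ _⟩
  | 1, P, Q, hP, hu, _, _ => by
    rw [NC_skew_one h2 hP] at hu
    exact absurd hu not_isUnit_zero
  | m + 2, P, Q, hP, hPu, hQ, hQu => by
    have e : Fin (m + 2) ≃ Fin 2 ⊕ Fin m := Fintype.equivOfCardEq (by simp [add_comm])
    apply NC_Cong_reindex e
    have hsym : ∀ A : Matrix (Fin (m + 2)) (Fin (m + 2)) F, Aᵀ = (-1 : F) • A →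
        (Matrix.reindex e e A)ᵀ = (-1 : F) • Matrix.reindex e e A := by
      intro A hA
      rw [Matrix.reindex_apply, Matrix.transpose_submatrix, hA]
      rfl
    have hun : ∀ A : Matrix (Fin (m + 2)) (Fin (m + 2)) F, IsUnit A →
        IsUnit (Matrix.reindex e e A) := by
      intro A hA
      rw [NC_rank_unit] at hA ⊢
      rw [Matrix.rank_reindex, hA, Fintype.card_congr e]
    obtain ⟨P', h1, h3, h4⟩ := NC_Cong_split h2 (hsym P hP) (hun P hPu)
    obtain ⟨Q', k1, k3, k4⟩ := NC_Cong_split h2 (hsym Q hQ) (hun Q hQu)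
    refine NC_Cong_trans h4 (NC_Cong_trans ?_ (NC_Cong_symm k4))
    obtain ⟨g, hg, rfl⟩ := NC_Cong_all h2 m P' Q' h1 h3 k1 k3
    refine ⟨fromBlocks 1 0 0 g, ?_, ?_⟩
    · rw [Matrix.isUnit_iff_isUnit_det, Matrix.det_fromBlocks_zero₁₂, Matrix.det_one, one_mul]
      exact (Matrix.isUnit_iff_isUnit_det g).1 hg
    · rw [Matrix.fromBlocks_transpose, Matrix.fromBlocks_multiply, Matrix.fromBlocks_multiply]
      simp

theorem NC_Cong_all' (h2 : (2 : F) ≠ 0) (P Q : Matrix ι ι F)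
    (hP : Pᵀ = (-1 : F) • P) (hPu : IsUnit P) (hQ : Qᵀ = (-1 : F) • Q) (hQu : IsUnit Q) :
    NC_Cong P Q := by
  have e : ι ≃ Fin (Fintype.card ι) := Fintype.equivFin ι
  apply NC_Cong_reindex e
  have hsym : ∀ A : Matrix ι ι F, Aᵀ = (-1 : F) • A →
      (Matrix.reindex e e A)ᵀ = (-1 : F) • Matrix.reindex e e A := by
    intro A hA
    rw [Matrix.reindex_apply, Matrix.transpose_submatrix, hA]
    rfl
  have hun : ∀ A : Matrix ι ι F, IsUnit A → IsUnit (Matrix.reindex e e A) := by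
    intro A hA
    rw [NC_rank_unit] at hA ⊢
    rw [Matrix.rank_reindex, hA, Fintype.card_fin]
  exact NC_Cong_all h2 _ _ _ (hsym P hP) (hun P hPu) (hsym Q hQ) (hun Q hQu)

theorem NC_rank_conj {A B h : Matrix ι ι F} (hh : IsUnit h) (e : A * h = h * B) (j : ℕ) :
    (A ^ j).rank = (B ^ j).rank := by
  have hd := (Matrix.isUnit_iff_isUnit_det h).1 hh
  have hs : SemiconjBy h B A := e.symm
  have := (hs.pow_right j).eq
  rw [← Matrix.rank_mul_eq_left_of_isUnit_det h (A ^ j) hd, ← this,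
    Matrix.rank_mul_eq_right_of_isUnit_det h (B ^ j) hd]

theorem NC_T_fixed [Fintype F] (h2 : (2 : F) ≠ 0) (Q : Matrix ι ι F)
    (hQ : Qᵀ = (-1 : F) • Q) (hQu : IsUnit Q) (R : ℕ → ℕ) :
    NC_T (-1 : F) ι R = NC_N (-1 : F) ι *
      Nat.card {S : Matrix ι ι F // Sᵀ = S ∧ ∀ j, ((Q * S) ^ j).rank = R j} := by
  unfold NC_T NC_N
  refine NC_card_fiber (fun X => ⟨X.1.1, X.2.1, X.2.2.1⟩) _ ?_
  rintro ⟨P, hP, hPu⟩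
  have h1 : Nat.card {S : Matrix ι ι F // Sᵀ = S ∧ ∀ j, ((P * S) ^ j).rank = R j} =
      Nat.card {S : Matrix ι ι F // Sᵀ = S ∧ ∀ j, ((Q * S) ^ j).rank = R j} := by
    obtain ⟨g, hg, rfl⟩ := NC_Cong_all' h2 P Q hP hPu hQ hQu
    have hgt := (Matrix.isUnit_transpose g).2 hg
    symm
    refine Nat.card_congr (Equiv.subtypeEquiv (NC_congrEquiv hgt) ?_)
    intro S
    have hs := NC_sym_congr (ε := (1 : F)) (P := S) hgt
    simp only [one_smul] at hs
    refine and_congr hs.symm (forall_congr' fun j => ?_)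
    have : ((gᵀ * P * g * S) ^ j).rank = ((P * (NC_congrEquiv hgt S)) ^ j).rank := by
      refine NC_rank_conj hgt ?_ j
      change gᵀ * P * g * S * gᵀ = gᵀ * (P * (gᵀᵀ * S * gᵀ))
      simp only [Matrix.transpose_transpose, Matrix.mul_assoc]
    rw [this]
  rw [← h1]
  refine Nat.card_congr
    { toFun := fun X => ⟨X.1.1.2, by simpa using X.1.2.2.2.1, ?_⟩
      invFun := fun S => ⟨⟨(P, S.1), hP, hPu, by simpa using S.2.1, S.2.2⟩, rfl⟩
      left_inv := ?_
      right_inv := fun S => rfl }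
  · have h3 := congrArg Subtype.val X.2
    dsimp only at h3
    have h5 := X.1.2.2.2.2
    rw [h3] at h5
    exact h5
  · rintro ⟨⟨⟨P1, S1⟩, h⟩, h3⟩
    have h4 := congrArg Subtype.val h3
    dsimp only at h4
    subst h4
    rfl

end NilCount6

section NilCount7

theorem NC_rank_eq_zero {F ι : Type*} [Field F] [Fintype ι] [DecidableEq ι] {A : Matrix ι ι F}
    (h : A.rank = 0) : A = 0 := by
  unfold Matrix.rank at h
  have h1 := Submodule.finrank_eq_zero.1 h
  rw [LinearMap.range_eq_bot] at h1
  ext i j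
  have h2 := congrFun (LinearMap.congr_fun h1 (Pi.single j 1)) i
  simpa using h2

/-- expected ranks -/
def NC_Rk (s : Multiset ℕ) (j : ℕ) : ℕ := (s.map (fun p => p - j)).sum

/-- conjugate partition -/
def NC_Kj (s : Multiset ℕ) (j : ℕ) : ℕ := Multiset.card (s.filter (fun p => j + 1 ≤ p))

theorem NC_Kj_cons (a : ℕ) (s : Multiset ℕ) (j : ℕ) :
    NC_Kj (a ::ₘ s) j = (if j + 1 ≤ a then 1 else 0) + NC_Kj s j := by
  unfold NC_Kj
  by_cases h : j + 1 ≤ a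
  · rw [Multiset.filter_cons_of_pos _ h, Multiset.card_cons, if_pos h, add_comm]
  · rw [Multiset.filter_cons_of_neg _ h, if_neg h, zero_add]

theorem NC_Rk_cons (a : ℕ) (s : Multiset ℕ) (j : ℕ) :
    NC_Rk (a ::ₘ s) j = (a - j) + NC_Rk s j := by
  simp [NC_Rk]

theorem NC_Rk_succ (s : Multiset ℕ) (j : ℕ) : NC_Rk s j = NC_Rk s (j + 1) + NC_Kj s j := by
  induction s using Multiset.induction with
  | empty => simp [NC_Rk, NC_Kj]
  | cons a s ih =>
    rw [NC_Rk_cons, NC_Rk_cons, NC_Kj_cons]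
    split_ifs <;> omega

theorem NC_Kj_succ (s : Multiset ℕ) (j : ℕ) :
    NC_Kj s j = NC_Kj s (j + 1) + Multiset.count (j + 1) s := by
  induction s using Multiset.induction with
  | empty => simp [NC_Kj]
  | cons a s ih =>
    rw [Multiset.count_cons, NC_Kj_cons, NC_Kj_cons]
    split_ifs <;> omega

theorem NC_Rk_zero (s : Multiset ℕ) : NC_Rk s 0 = s.sum := by
  simp [NC_Rk]

theorem NC_Rk_sum (s : Multiset ℕ) : NC_Rk s s.sum = 0 := by
  unfold NC_Rk
  rw [Multiset.sum_eq_zero_iff]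
  intro x hx
  obtain ⟨p, hp, rfl⟩ := Multiset.mem_map.1 hx
  have := Multiset.single_le_sum (fun x _ => Nat.zero_le x) p hp
  omega

theorem NC_min_sum (s : Multiset ℕ) (k : ℕ) :
    (s.map (fun p => min k p)).sum + NC_Rk s k = s.sum := by
  unfold NC_Rk
  induction s using Multiset.induction with
  | empty => simp
  | cons a s ih =>
    simp only [Multiset.map_cons, Multiset.sum_cons]
    omega

theorem NC_not_iter (i : ℕ) : (not^[i] false) = decide (i % 2 = 1) := by
  induction i with
  | zero => rfl
  | succ i ih =>
    rw [Function.iterate_succ_apply', ih]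
    rcases Nat.mod_two_eq_zero_or_one i with h | h
    · have : (i + 1) % 2 = 1 := by omega
      simp [h, this]
    · have : (i + 1) % 2 = 0 := by omega
      simp [h, this]

theorem NC_W_eq (q : ℝ) (L : ℕ) : ∀ (b : Bool) (K M : ℕ → ℕ), NC_W q L b K M =
    q ^ (∑ i ∈ Finset.range L, NC_sd (not^[i + 1] b) (K i)) *
      ∏ i ∈ Finset.range L, NC_phi q (M i / 2) := by
  induction L with
  | zero => intro b K M; simp [NC_W]
  | succ L ih =>
    intro b K M
    rw [NC_W, ih, Finset.sum_range_succ', Finset.prod_range_succ', pow_add]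
    simp only [Function.iterate_succ_apply, Function.iterate_zero_apply]
    ring

theorem NC_alt (L a : ℕ) : ∑ i ∈ Finset.range L, (-1 : ℤ) ^ i * (if i + 1 ≤ a then 1 else 0) =
    if Odd (min L a) then 1 else 0 := by
  induction L with
  | zero => simp
  | succ L ih =>
    rw [Finset.sum_range_succ, ih]
    by_cases h : L + 1 ≤ a
    · rw [if_pos h, min_eq_left (by omega), min_eq_left (by omega)]
      by_cases h1 : Odd L
      · rw [if_pos h1, if_neg (by simpa [Nat.even_add_one] using h1), h1.neg_one_pow]; simp
      · rw [if_neg h1, if_pos (by rw [Nat.odd_add_one]; exact h1), (Nat.not_odd_iff_even.1 h1).neg_one_pow]; simp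
    · rw [if_neg h, min_eq_right (by omega), min_eq_right (by omega)]; simp

theorem NC_alt_sum (L : ℕ) (s : Multiset ℕ) (hs : ∀ p ∈ s, p ≤ L) :
    ∑ i ∈ Finset.range L, (-1 : ℤ) ^ i * (NC_Kj s i : ℤ) =
      Multiset.card (s.filter (fun p => Odd p)) := by
  induction s using Multiset.induction with
  | empty => simp [NC_Kj]
  | cons a s ih =>
    have h1 : ∀ i, (NC_Kj (a ::ₘ s) i : ℤ) = (if i + 1 ≤ a then 1 else 0) + NC_Kj s i := by
      intro i
      rw [NC_Kj_cons]
      push_cast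
      rfl
    simp only [h1, mul_add]
    rw [Finset.sum_add_distrib, NC_alt, ih (fun p hp => hs p (Multiset.mem_cons_of_mem hp)),
      min_eq_right (hs a (Multiset.mem_cons_self a s)), Multiset.filter_cons]
    split_ifs <;> simp [add_comm]

theorem NC_sd_two (i k : ℕ) : (2 * NC_sd (not^[i + 1] false) k : ℤ) = k ^ 2 + (-1) ^ i * k := by
  rw [NC_not_iter]
  have hc : ∀ m : ℕ, (2 * (m + 1).choose 2 : ℤ) = m ^ 2 + m := by
    intro m
    induction m with
    | zero => simp
    | succ m ih =>
      rw [Nat.choose_succ_succ' _ 1, Nat.choose_one_right]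
      push_cast
      linear_combination ih
  rcases Nat.even_or_odd i with h | h
  · have h1 : (i + 1) % 2 = 1 := by obtain ⟨t, rfl⟩ := h; omega
    rw [h.neg_one_pow]
    simp only [NC_sd, h1, decide_true, if_true, one_mul]
    exact hc k
  · have h1 : (i + 1) % 2 = 0 := by obtain ⟨t, rfl⟩ := h; omega
    rw [h.neg_one_pow]
    simp only [NC_sd, h1]
    cases k with
    | zero => simp
    | succ k =>
      have := hc k
      simp only [zero_ne_one, decide_false, Bool.false_eq_true, if_false]
      push_cast
      linear_combination this

theorem NC_phi_prod {q : ℝ} (hq : 1 < q) (n : ℕ) :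
    NC_phi q n * q ^ (n ^ 2 + n) = ∏ i ∈ Finset.range n, (q ^ (2 * (i + 1)) - 1) := by
  induction n with
  | zero => simp [NC_phi]
  | succ n ih =>
    rw [Finset.prod_range_succ, ← ih]
    have h := NC_phi_succ hq n
    rw [show (n + 1) ^ 2 + (n + 1) = (2 * n + 2) + (n ^ 2 + n) by ring, pow_add, ← mul_assoc, h]
    ring

end NilCount7

theorem card_nilpotent_class_symplectic
    (q : ℕ) (hq : ∃ p m : ℕ, p.Prime ∧ 0 < m ∧ q = p ^ m) (hodd : Odd q)
    (F : Type) [Field F] [Fintype F] (hF : Fintype.card F = q)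
    (n : ℕ) (hn : 1 ≤ n) (lam : Nat.Partition (2 * n))
    (hmult : ∀ i : ℕ, Odd i → Even (Multiset.count i lam.parts)) :
    ∃ e : ℕ,
      2 * e = (∑ k ∈ Finset.range (2 * n),
          (Multiset.card (lam.parts.filter (fun p => k + 1 ≤ p))) ^ 2) +
        Multiset.card (lam.parts.filter (fun p => Odd p)) ∧
      (Nat.card {x : Matrix (Fin n ⊕ Fin n) (Fin n ⊕ Fin n) F //
          x * sympJ F n = (x * sympJ F n)ᵀ ∧ x ^ (2 * n) = 0 ∧
          ∀ k : ℕ, 1 ≤ k → ((2 * n : ℕ) : ℤ) - Matrix.rank (x ^ k) =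
            (lam.parts.map (fun p => min k p)).sum} : ℝ) =
        spOrder q n / ((q : ℝ) ^ e *
          ∏ i ∈ Finset.range (2 * n),
            ∏ j ∈ Finset.range (Multiset.count (i + 1) lam.parts / 2),
              (1 - (q : ℝ) ^ (-(2 * (j + 1) : ℤ)))) := by
  set s := lam.parts with hs
  have hsum : s.sum = 2 * n := lam.parts_sum
  have h2 : (2 : F) ≠ 0 := by
    intro h
    obtain ⟨k, hk⟩ := hodd
    have h0 : ((Fintype.card F : ℕ) : F) = 0 := Nat.cast_card_eq_zero F
    rw [hF, hk] at h0
    push_cast at h0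
    rw [h, zero_mul, zero_add] at h0
    exact one_ne_zero h0
  have hq1 : (1 : ℝ) < (q : ℝ) := by rw [← hF]; exact_mod_cast Fintype.one_lt_card
  refine ⟨∑ i ∈ Finset.range (2 * n), NC_sd (not^[i + 1] false) (NC_Kj s i), ?_, ?_⟩
  · have hle : ∀ p ∈ s, p ≤ 2 * n := fun p hp => by
      rw [← hsum]; exact Multiset.single_le_sum (fun x _ => Nat.zero_le x) p hp
    have h3 := NC_alt_sum (2 * n) s hle
    change 2 * _ = (∑ k ∈ Finset.range (2 * n), NC_Kj s k ^ 2) + _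
    zify
    rw [Finset.mul_sum, Finset.sum_congr rfl (fun i _ => NC_sd_two i (NC_Kj s i)),
      Finset.sum_add_distrib, h3]
  · set J := sympJ F n with hJ
    have hJJ : J * J = -1 := by
      rw [hJ, sympJ, Matrix.fromBlocks_multiply, ← Matrix.fromBlocks_one, Matrix.fromBlocks_neg]
      simp
    have hJt : Jᵀ = -J := by
      rw [hJ, sympJ, Matrix.fromBlocks_transpose, Matrix.fromBlocks_neg]
      simp
    have hQ : (-J)ᵀ = (-1 : F) • (-J) := by rw [Matrix.transpose_neg, hJt]; simp
    have hJQ : J * (-J) = 1 := by rw [Matrix.mul_neg, hJJ, neg_neg]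
    have hQJ : (-J) * J = 1 := by rw [Matrix.neg_mul, hJJ, neg_neg]
    have hQu : IsUnit (-J) := IsUnit.of_mul_eq_one _ hQJ
    have hrk : ∀ (x : Matrix (Fin n ⊕ Fin n) (Fin n ⊕ Fin n) F) (j : ℕ),
        (((-J) * (x * J)) ^ j).rank = (x ^ j).rank := by
      intro x j
      refine NC_rank_conj hQu ?_ j
      rw [Matrix.mul_assoc, Matrix.mul_assoc x, hJQ, Matrix.mul_one]
    have hcard : Nat.card {x : Matrix (Fin n ⊕ Fin n) (Fin n ⊕ Fin n) F //
          x * J = (x * J)ᵀ ∧ x ^ (2 * n) = 0 ∧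
          ∀ k : ℕ, 1 ≤ k → ((2 * n : ℕ) : ℤ) - Matrix.rank (x ^ k) =
            (s.map (fun p => min k p)).sum} =
        Nat.card {S : Matrix (Fin n ⊕ Fin n) (Fin n ⊕ Fin n) F //
          Sᵀ = S ∧ ∀ j, (((-J) * S) ^ j).rank = NC_Rk s j} := by
      refine Nat.card_congr (Equiv.subtypeEquiv
        { toFun := fun x => x * J
          invFun := fun x => x * (-J)
          left_inv := fun x => by dsimp only; rw [Matrix.mul_assoc, hJQ, Matrix.mul_one]
          right_inv := fun x => by dsimp only; rw [Matrix.mul_assoc, hQJ, Matrix.mul_one] } ?_)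
      intro x
      simp only [Equiv.coe_fn_mk]
      refine and_congr eq_comm ?_
      simp only [hrk]
      constructor
      · rintro ⟨_, h⟩ j
        rcases j with _ | j
        · rw [pow_zero, Matrix.rank_one, NC_Rk_zero, hsum]
          simp [two_mul]
        · have h3 := h (j + 1) (by omega)
          have h4 := NC_min_sum s (j + 1)
          rw [hsum] at h4
          zify at h4 ⊢
          push_cast at h3
          linarith
      · intro h
        refine ⟨?_, fun k _ => ?_⟩
        · have h3 := h (2 * n)
          rw [← hsum, NC_Rk_sum] at h3
          rw [← hsum]
          exact NC_rank_eq_zero h3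
        · have h4 := NC_min_sum s k
          rw [hsum] at h4
          rw [h k]
          zify at h4
          push_cast
          linarith
    have hR0 : NC_Rk s 0 = 2 * n := by rw [NC_Rk_zero, hsum]
    have e : Fin n ⊕ Fin n ≃ Fin (2 * n) := Fintype.equivOfCardEq (by simp [two_mul])
    have hT := NC_T_formula h2 (2 * n) false (NC_Rk s) (NC_Kj s) (fun i => Multiset.count (i + 1) s)
      (NC_Rk_succ s) (NC_Kj_succ s) (by rw [← hsum, NC_Rk_sum]) (by
        intro i hi
        rw [NC_not_iter] at hi
        apply hmult
        rw [Nat.odd_iff]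
        have := of_decide_eq_false hi
        omega)
    have hsg : NC_sg F false = -1 := rfl
    rw [hR0, ← NC_T_congr _ e, hsg, NC_T_fixed h2 (-J) hQ hQu, ← hcard, NC_W_eq, hF] at hT
    have hN := NC_N_formula h2 false (2 * n) (fun _ => even_two_mul n)
    rw [hsg, ← NC_N_congr _ e, hF, Nat.mul_div_cancel_left _ two_pos, ← hT] at hN
    have hNne : (NC_N (-1 : F) (Fin n ⊕ Fin n) : ℝ) ≠ 0 := by
      intro h0
      rw [Nat.cast_mul, h0, zero_mul, zero_mul] at hT
      exact (NC_G_pos hq1 (2 * n)).ne hT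
    rw [Nat.cast_mul, mul_assoc] at hN
    have hfin := mul_left_cancel₀ hNne hN
    have hsp : spOrder q n = (q : ℝ) ^ NC_sd true (2 * n) * NC_phi q n := by
      rw [spOrder, ← NC_phi_prod hq1 n]
      have hch : NC_sd true (2 * n) = n ^ 2 + (n ^ 2 + n) := by
        have h5 := NC_sd_two 0 (2 * n)
        have h6 : (not^[0 + 1] false) = true := rfl
        rw [h6] at h5
        zify
        push_cast at h5
        linarith
      rw [hch, pow_add]
      ring
    rw [hsp]
    rw [eq_div_iff]
    · exact hfin.symm
    · refine mul_ne_zero (by positivity) ?_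
      exact Finset.prod_ne_zero_iff.2 fun i _ => (NC_phi_pos hq1 _).ne'
end
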